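/- arXiv:1902.01753 — 2 statements merged into one kernel-verified Lean document; each statement's English description precedes it below -/
import Mathlib

section
/- Let X ∈ ℝ^{n×p} have i.i.d. N(0,1/n) entries with n = δp for fixed δ > 1, and set σ_δ := (1/2)·min{ (1 − √(1/δ))², 1/δ }. Then there exists a constant c > 0 such that for large enough n, with probability at least 1 − 8(p−1)(n+p+1)e^{−cn}, all of the following hold simultaneously: σ_max(XᵀX) ≤ 9δ²; max_{1≤i≤n} σ_max(X_{/i}ᵀ X_{/i}) ≤ 9δ²; max_{1≤i≤p} σ_max( X̄_{/i} X̄_{/i}ᵀ ) ≤ 9δ²; max_{1≤i≤p} σ_max( X̄_{/i}ᵀ X̄_{/i} ) ≤ 9δ²; σ_min(XᵀX) ≥ σ_δ; min_{1≤i≤n} σ_min(X_{/i}ᵀ X_{/i}) ≥ σ_δ; and min_{1≤i≤p} σ_min( X̄_{/i}ᵀ X̄_{/i} ) ≥ σ_δ. -/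
open MeasureTheory ProbabilityTheory Matrix Filter Finset
open scoped NNReal ENNReal

noncomputable section

/-- The second derivative of a function `ℝ → ℝ`. -/
def D2 (f : ℝ → ℝ) : ℝ → ℝ := deriv (deriv f)

/-- The average `⟨v⟩` of the entries of a finite vector. -/
def avg {m : ℕ} (v : Fin m → ℝ) : ℝ := (∑ i, v i) / m

/-- The Euclidean norm of a finite vector. -/
def vnorm {m : ℕ} (v : Fin m → ℝ) : ℝ := Real.sqrt (∑ i, v i ^ 2)

/-- `Z = O_p(a)`: stochastic boundedness in probability at rate `a`. -/
def IsBigOp {Ω : Type} [MeasureSpace Ω] (Z : ℕ → Ω → ℝ) (a : ℕ → ℝ) : Prop :=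
  ∀ ε : ℝ, 0 < ε → ∃ C : ℝ, 0 < C ∧ ∃ N : ℕ, ∀ k : ℕ, N < k →
    (MeasureTheory.volume {ω : Ω | C * a k < |Z k ω|}).toReal ≤ ε

/-- `Z = O_p(plog(n) · a)`: stochastic boundedness up to a polylogarithmic factor in `n`. -/
def IsBigOpPlog {Ω : Type} [MeasureSpace Ω] (Z : ℕ → Ω → ℝ) (nn : ℕ → ℕ) (a : ℕ → ℝ) : Prop :=
  ∃ m : ℕ, IsBigOp Z fun k => Real.log (nn k) ^ m * a k

/-- The response vector `y = Xβ₀ + w`. -/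
def yvec {n p : ℕ} (X : Matrix (Fin n) (Fin p) ℝ) (b0 : Fin p → ℝ) (w : Fin n → ℝ) :
    Fin n → ℝ := X *ᵥ b0 + w

/-- The residual vector `y - Xb`. -/
def resid {n p : ℕ} (X : Matrix (Fin n) (Fin p) ℝ) (y : Fin n → ℝ) (b : Fin p → ℝ) :
    Fin n → ℝ := fun i => y i - (X *ᵥ b) i

/-- The penalized empirical risk objective. -/
def obj (l R : ℝ → ℝ) (lam : ℝ) {n p : ℕ} (X : Matrix (Fin n) (Fin p) ℝ)
    (y : Fin n → ℝ) (b : Fin p → ℝ) : ℝ :=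
  (∑ i, l (y i - (X *ᵥ b) i)) + lam * ∑ j, R (b j)

/-- The leave-observation-`i`-out objective. -/
def objLoo (l R : ℝ → ℝ) (lam : ℝ) {n p : ℕ} (X : Matrix (Fin n) (Fin p) ℝ)
    (y : Fin n → ℝ) (i : Fin n) (b : Fin p → ℝ) : ℝ :=
  (∑ j ∈ Finset.univ.erase i, l (y j - (X *ᵥ b) j)) + lam * ∑ j, R (b j)

/-- The matrix `Xᵀ diag(l''(y - Xb)) X - l''((y-Xb)_i) x_i x_iᵀ + λ diag(R''(b) + c₃)`;
with `c₃ = 0` this is `Ã_i` (for `b` the leave-`i`-out estimate) or `Â_i` (for `b = β̂`). -/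
def Amat (l R : ℝ → ℝ) (lam c3 : ℝ) {n p : ℕ} (X : Matrix (Fin n) (Fin p) ℝ)
    (y : Fin n → ℝ) (i : Fin n) (b : Fin p → ℝ) : Matrix (Fin p) (Fin p) ℝ :=
  Xᵀ * Matrix.diagonal (fun j => D2 l (resid X y b j)) * X
    - D2 l (resid X y b i) • Matrix.vecMulVec (X i) (X i)
    + lam • Matrix.diagonal (fun j => D2 R (b j) + c3)

/-- The matrix `Xᵀ diag(l''(y - Xb)) X + λ diag(R''(b) + c₃)` (no rank-one correction). -/
def Afull (l R : ℝ → ℝ) (lam c3 : ℝ) {n p : ℕ} (X : Matrix (Fin n) (Fin p) ℝ)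
    (y : Fin n → ℝ) (b : Fin p → ℝ) : Matrix (Fin p) (Fin p) ℝ :=
  Xᵀ * Matrix.diagonal (fun j => D2 l (resid X y b j)) * X
    + lam • Matrix.diagonal (fun j => D2 R (b j) + c3)

/-- Law of a vector with iid `N(0,v)` coordinates. -/
def GV (v : ℝ≥0) (q : ℕ) : Measure (Fin q → ℝ) := Measure.pi fun _ => gaussianReal 0 v

/-- Law of an `m × q` matrix with iid `N(0,v)` entries. -/
def GM (v : ℝ≥0) (m q : ℕ) : Measure (Fin m → Fin q → ℝ) := Measure.pi fun _ => GV v q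

instance (v : ℝ≥0) (q : ℕ) : IsProbabilityMeasure (GV v q) := by unfold GV; infer_instance
instance (v : ℝ≥0) (m q : ℕ) : IsProbabilityMeasure (GM v m q) := by unfold GM; infer_instance

lemma GV_rot (v : ℝ≥0) (q : ℕ) (U : Matrix (Fin q) (Fin q) ℝ) (hU : U * Uᵀ = 1) :
    MeasurePreserving (fun x => U *ᵥ x) (GV v q) (GV v q) := by
  have hm : Measurable (fun x : Fin q → ℝ => U *ᵥ x) := by
    apply Continuous.measurable; fun_prop
  refine ⟨hm, ?_⟩
  have := Measure.isProbabilityMeasure_map (μ := GV v q) hm.aemeasurable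
  have key : ∀ t : EuclideanSpace ℝ (Fin q),
      charFun ((GV v q).map (WithLp.toLp 2)) t = Complex.exp (-(v:ℂ) * ((t.ofLp ⬝ᵥ t.ofLp : ℝ) : ℂ) / 2) := by
    intro t
    unfold GV
    rw [charFun_pi]
    simp only [charFun_gaussianReal]
    rw [← Complex.exp_sum]
    congr 1
    simp only [dotProduct, Complex.ofReal_sum, Finset.mul_sum, Finset.sum_div]
    apply Finset.sum_congr rfl
    intro i _
    push_cast
    ring
  refine (MeasurableEquiv.toLp 2 (Fin q → ℝ)).map_measurableEquiv_injective
      <| Measure.ext_of_charFun (E := EuclideanSpace ℝ (Fin q)) <| funext fun t ↦ ?_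
  rw [MeasurableEquiv.coe_toLp, key]
  have h2 := key (WithLp.toLp 2 (Uᵀ *ᵥ t.ofLp))
  have h3 : (Uᵀ *ᵥ t.ofLp) ⬝ᵥ (Uᵀ *ᵥ t.ofLp) = t.ofLp ⬝ᵥ t.ofLp := by
    rw [Matrix.dotProduct_mulVec, Matrix.vecMul_transpose, Matrix.mulVec_mulVec, hU, Matrix.one_mulVec]
  simp only [h3] at h2
  rw [← h2]
  rw [charFun_apply, charFun_apply, Measure.map_map (by fun_prop) hm,
    integral_map (by fun_prop) (by fun_prop), integral_map (by fun_prop) (by fun_prop)]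
  congr 1
  ext x
  congr 3
  simp only [Function.comp, EuclideanSpace.inner_eq_star_dotProduct, star_trivial]
  rw [Matrix.dotProduct_mulVec, Matrix.mulVec_transpose]

/-- Householder rotation sending `a` to `|a| e₀`. -/
lemma exists_rot {q : ℕ} (a : Fin (q+1) → ℝ) : ∃ U : Matrix (Fin (q+1)) (Fin (q+1)) ℝ,
    U * Uᵀ = 1 ∧ U *ᵥ a = Pi.single 0 (Real.sqrt (a ⬝ᵥ a)) := by
  set w : Fin (q+1) → ℝ := a - Pi.single 0 (Real.sqrt (a ⬝ᵥ a)) with hw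
  have h0 : 0 ≤ a ⬝ᵥ a := by
    simp only [dotProduct]; exact Finset.sum_nonneg fun i _ => mul_self_nonneg _
  have hs := Real.mul_self_sqrt h0
  set s := Real.sqrt (a ⬝ᵥ a)
  by_cases hw0 : w = 0
  · refine ⟨1, by simp, ?_⟩
    rw [Matrix.one_mulVec]
    exact sub_eq_zero.mp hw0
  have hww : w ⬝ᵥ w ≠ 0 := by
    intro h; exact hw0 (dotProduct_self_eq_zero.mp h)
  have hwa : w ⬝ᵥ w = 2 * (w ⬝ᵥ a) := by
    simp only [hw, sub_dotProduct, dotProduct_sub, single_dotProduct, dotProduct_single, Pi.sub_apply, Pi.single_eq_same]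
    linarith
  refine ⟨1 - (2 / (w ⬝ᵥ w)) • vecMulVec w w, ?_, ?_⟩
  · rw [Matrix.transpose_sub, Matrix.transpose_smul, Matrix.transpose_vecMulVec, Matrix.transpose_one]
    rw [sub_mul, mul_sub, mul_sub, Matrix.smul_mul, Matrix.smul_mul, Matrix.mul_smul, Matrix.mul_smul,
      Matrix.vecMulVec_mul_vecMulVec]
    simp only [mul_one, one_mul, Matrix.vecMulVec_smul, smul_smul]
    have : 2 / (w ⬝ᵥ w) * (2 / (w ⬝ᵥ w) * (w ⬝ᵥ w)) = 2 / (w ⬝ᵥ w) + 2 / (w ⬝ᵥ w) := by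
      field_simp; ring
    rw [this, add_smul]; abel
  · rw [Matrix.sub_mulVec, Matrix.one_mulVec, Matrix.smul_mulVec, Matrix.vecMulVec_mulVec]
    have : (2 / (w ⬝ᵥ w)) * (w ⬝ᵥ a) = 1 := by
      have h5 : w ⬝ᵥ a ≠ 0 := fun h => hww (by rw [hwa, h, mul_zero])
      rw [hwa]; field_simp
    have h4 : (2 / (w ⬝ᵥ w)) • (MulOpposite.op (w ⬝ᵥ a) • w) = w := by
      ext i
      simp only [Pi.smul_apply, smul_eq_mul, MulOpposite.smul_eq_mul_unop, MulOpposite.unop_op]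
      linear_combination (w i) * this
    rw [h4, hw]; abel

lemma GM_curry (v : ℝ≥0) (m q : ℕ) : MeasurePreserving (MeasurableEquiv.curry (Fin m) (Fin q) ℝ)
    (Measure.pi fun _ => gaussianReal 0 v) (GM v m q) := by
  refine MeasurePreserving.symm (MeasurableEquiv.curry (Fin m) (Fin q) ℝ).symm ?_
  refine ⟨(MeasurableEquiv.curry (Fin m) (Fin q) ℝ).symm.measurable, (Measure.pi_eq fun s hs => ?_).symm⟩
  rw [MeasurableEquiv.map_apply]
  have : (MeasurableEquiv.curry (Fin m) (Fin q) ℝ).symm ⁻¹' (Set.pi Set.univ s)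
    = Set.pi Set.univ (fun i => Set.pi Set.univ fun j => s (i, j)) := by
    ext A
    simp [Set.mem_pi, Function.uncurry]
  rw [this]
  unfold GM GV
  rw [Measure.pi_pi]
  simp only [Measure.pi_pi]
  rw [Fintype.prod_prod_type]

lemma GM_swap (v : ℝ≥0) (m q : ℕ) : MeasurePreserving (fun (A : Fin m → Fin q → ℝ) j i => A i j)
    (GM v m q) (GM v q m) := by
  have h1 := (GM_curry v m q).symm
  have h2 := measurePreserving_piCongrLeft (α := fun _ : Fin q × Fin m => ℝ)
    (fun _ : Fin q × Fin m => gaussianReal 0 v) (Equiv.prodComm (Fin m) (Fin q))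
  have h3 := (GM_curry v q m)
  convert (h3.comp h2).comp h1 using 1
  funext A j i
  simp only [Function.comp, MeasurableEquiv.coe_curry, Function.curry, MeasurableEquiv.coe_piCongrLeft,
    MeasurableEquiv.coe_curry_symm]
  exact (Equiv.piCongrLeft_apply_apply (fun _ : Fin q × Fin m => ℝ) (Equiv.prodComm (Fin m) (Fin q))
    (Function.uncurry A) (i, j)).symm

lemma GM_rot_right (v : ℝ≥0) (m q : ℕ) (U : Matrix (Fin q) (Fin q) ℝ) (hU : U * Uᵀ = 1) :
    MeasurePreserving (fun (A : Fin m → Fin q → ℝ) i => U *ᵥ A i) (GM v m q) (GM v m q) :=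
  measurePreserving_pi _ _ fun _ => GV_rot v q U hU

lemma GM_rot_left (v : ℝ≥0) (m q : ℕ) (U : Matrix (Fin m) (Fin m) ℝ) (hU : U * Uᵀ = 1) :
    MeasurePreserving (fun (A : Fin m → Fin q → ℝ) i j => ∑ k, U i k * A k j) (GM v m q) (GM v m q) :=
  (GM_swap v q m).comp ((GM_rot_right v q m U hU).comp (GM_swap v m q))

lemma GV_cons (v : ℝ≥0) (q : ℕ) :
    MeasurePreserving (fun z : ℝ × (Fin q → ℝ) => (Fin.cons z.1 z.2 : Fin (q+1) → ℝ))
    ((gaussianReal 0 v).prod (GV v q)) (GV v (q+1)) := by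
  have := (measurePreserving_piFinSuccAbove (fun _ : Fin (q+1) => gaussianReal 0 v) 0).symm
  convert! this using 1
  ext z i
  simp [MeasurableEquiv.piFinSuccAbove, Fin.insertNthEquiv]

lemma GM_cons_row (v : ℝ≥0) (m q : ℕ) :
    MeasurePreserving (fun z : (Fin q → ℝ) × (Fin m → Fin q → ℝ) => (Fin.cons z.1 z.2 : Fin (m+1) → Fin q → ℝ))
    ((GV v q).prod (GM v m q)) (GM v (m+1) q) := by
  have := (measurePreserving_piFinSuccAbove (fun _ : Fin (m+1) => GV v q) 0).symm
  convert! this using 1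
  ext z i
  simp [MeasurableEquiv.piFinSuccAbove, Fin.insertNthEquiv]

lemma GM_remove_row (v : ℝ≥0) (m q : ℕ) (i : Fin (m+1)) :
    MeasurePreserving (fun (A : Fin (m+1) → Fin q → ℝ) j => A (i.succAbove j))
    (GM v (m+1) q) (GM v m q) := by
  have := (measurePreserving_piFinSuccAbove (fun _ : Fin (m+1) => GV v q) i)
  exact (measurePreserving_snd).comp this

lemma GM_cons_col (v : ℝ≥0) (m q : ℕ) :
    MeasurePreserving (fun z : (Fin m → ℝ) × (Fin m → Fin q → ℝ) =>
      (fun i => Fin.cons (z.1 i) (z.2 i) : Fin m → Fin (q+1) → ℝ))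
    ((GV v m).prod (GM v m q)) (GM v m (q+1)) := by
  have h1 := (measurePreserving_arrowProdEquivProdArrow ℝ (Fin q → ℝ) (Fin m)
    (fun _ => gaussianReal 0 v) (fun _ => GV v q)).symm
  have h2 := measurePreserving_pi (fun _ : Fin m => (gaussianReal 0 v).prod (GV v q)) _
    fun _ => GV_cons v q
  exact h2.comp h1

lemma prod_bound {α β : Type*} [MeasurableSpace α] [MeasurableSpace β] (μ : Measure α) (ν : Measure β)
    [IsProbabilityMeasure μ] [IsProbabilityMeasure ν] (S : Set (α × β)) (hS : MeasurableSet S)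
    (T : Set α) (hT : MeasurableSet T) (c : ℝ≥0∞)
    (h : ∀ a, a ∉ T → ν {b | (a, b) ∈ S} ≤ c) : (μ.prod ν) S ≤ μ T + c := by
  rw [Measure.prod_apply hS]
  calc ∫⁻ a, ν (Prod.mk a ⁻¹' S) ∂μ ≤ ∫⁻ a, (T.indicator 1 a + c) ∂μ := by
        apply lintegral_mono
        intro a
        by_cases ha : a ∈ T
        · simp only [ha, Set.indicator_of_mem, Pi.one_apply]
          exact prob_le_one.trans le_self_add
        · simp only [ha, not_false_eq_true, Set.indicator_of_notMem, zero_add]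
          exact h a ha
    _ = μ T + c := by
        rw [lintegral_add_right _ measurable_const, lintegral_indicator_one hT]
        simp

lemma exp_aux (y : ℝ) (hy : |y| ≤ 1 / 2) : 1 ≤ (1 - y) * Real.exp (y + y ^ 2) := by
  obtain ⟨h1, h2⟩ := abs_le.mp hy
  rcases le_total 0 y with h | h
  · have := Real.quadratic_le_exp_of_nonneg (x := y + y ^ 2) (by positivity)
    have h3 : (1 - y) * (1 + (y + y ^ 2) + (y + y ^ 2) ^ 2 / 2) ≤ (1 - y) * Real.exp (y + y ^ 2) := by
      apply mul_le_mul_of_nonneg_left this; linarith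
    have h4 : 0 ≤ y ^ 2 * ((1 - y - y ^ 2 - y ^ 3) / 2) := by
      apply mul_nonneg (sq_nonneg _)
      have : y ^ 2 ≤ 1 / 4 := by nlinarith
      have : y ^ 3 ≤ 1 / 8 := by
        have : y ^ 3 = y * y ^ 2 := by ring
        nlinarith
      linarith
    nlinarith
  · have := Real.add_one_le_exp (y + y ^ 2)
    have h3 : (1 - y) * (y + y ^ 2 + 1) ≤ (1 - y) * Real.exp (y + y ^ 2) := by
      apply mul_le_mul_of_nonneg_left this; linarith
    have h4 : 0 ≤ (-y) * y ^ 2 := mul_nonneg (by linarith) (sq_nonneg _)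
    nlinarith

lemma gauss_sq_mgf (n : ℕ) (hn : 0 < n) (η : ℝ) (hη : |η| ≤ 1 / 4) :
    Integrable (fun x : ℝ => Real.exp (η * n * x ^ 2)) (gaussianReal 0 ((n : ℝ≥0))⁻¹) ∧
    ∫ x, Real.exp (η * n * x ^ 2) ∂(gaussianReal 0 ((n : ℝ≥0))⁻¹) ≤ Real.exp (η + 2 * η ^ 2) := by
  obtain ⟨h1, h2⟩ := abs_le.mp hη
  have hn' : (0:ℝ) < n := by exact_mod_cast hn
  have hv : ((n : ℝ≥0))⁻¹ ≠ 0 := by positivity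
  set b : ℝ := n / 2 * (1 - 2 * η) with hb
  have hbpos : 0 < b := by apply mul_pos <;> linarith
  have hpdf : ∀ x : ℝ, gaussianPDFReal 0 ((n : ℝ≥0))⁻¹ x * Real.exp (η * n * x ^ 2)
      = (Real.sqrt (2 * Real.pi * (n:ℝ)⁻¹))⁻¹ * Real.exp (-b * x ^ 2) := by
    intro x
    rw [gaussianPDFReal, mul_assoc, ← Real.exp_add]
    congr 2
    simp only [NNReal.coe_inv, NNReal.coe_natCast, hb]
    field_simp
    ring
  constructor
  · rw [gaussianReal_of_var_ne_zero _ hv]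
    rw [integrable_withDensity_iff_integrable_smul' (by fun_prop) (by
      filter_upwards with x; simp [gaussianPDF])]
    simp only [toReal_gaussianPDF, smul_eq_mul, hpdf]
    exact (integrable_exp_neg_mul_sq hbpos).const_mul _
  · rw [integral_gaussianReal_eq_integral_smul hv]
    simp only [smul_eq_mul, hpdf]
    rw [integral_const_mul, integral_gaussian, ← Real.sqrt_inv, ← Real.sqrt_mul (by positivity)]
    apply Real.sqrt_le_iff.mpr
    refine ⟨(Real.exp_pos _).le, ?_⟩
    have h3 := exp_aux (2 * η) (by rw [abs_mul]; norm_num; linarith)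
    have h4 : (2 * Real.pi * (n:ℝ)⁻¹)⁻¹ * (Real.pi / b) = 1 / (1 - 2 * η) := by
      have : (1 - 2 * η) ≠ 0 := by linarith
      rw [hb]
      have := Real.pi_ne_zero
      field_simp
    rw [h4, ← Real.exp_nat_mul, div_le_iff₀ (by linarith)]
    calc (1:ℝ) ≤ _ := h3
      _ = _ := by rw [mul_comm]; congr 2; push_cast; ring

lemma chernoff (n m : ℕ) (hn : 0 < n) (hm : m ≤ n) (η ε : ℝ) (hη : |η| ≤ 1 / 4) :
    GV ((n : ℝ≥0))⁻¹ m {a | |η| * ε ≤ η * (a ⬝ᵥ a - m / n)} ≤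
      ENNReal.ofReal (Real.exp (-(n * (|η| * ε - 2 * η ^ 2)))) := by
  obtain ⟨hi, hle⟩ := gauss_sq_mgf n hn η hη
  have hn' : (0:ℝ) < n := by exact_mod_cast hn
  set F : (Fin m → ℝ) → ℝ := fun a => η * (a ⬝ᵥ a - m / n) with hF
  have hexp : ∀ a, Real.exp (n * F a) = Real.exp (-(η * m)) * ∏ i, Real.exp (η * n * (a i) ^ 2) := by
    intro a
    rw [← Real.exp_sum, ← Real.exp_add]
    congr 1
    simp only [hF, dotProduct, ← Finset.mul_sum]
    have : ∑ i, a i * a i = ∑ i, a i ^ 2 := Finset.sum_congr rfl fun i _ => by ring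
    rw [this]
    field_simp
    ring
  have hint : Integrable (fun a => Real.exp (n * F a)) (GV ((n : ℝ≥0))⁻¹ m) := by
    simp only [hexp]
    apply Integrable.const_mul
    unfold GV
    exact Integrable.fintype_prod (f := fun (_ : Fin m) (x : ℝ) => Real.exp (η * n * x ^ 2)) (fun _ => hi)
  have h1 := measure_ge_le_exp_mul_mgf (μ := GV ((n : ℝ≥0))⁻¹ m) (X := F) (|η| * ε) hn'.le hint
  have h2 : mgf F (GV ((n : ℝ≥0))⁻¹ m) n ≤ Real.exp (n * (2 * η ^ 2)) := by
    unfold mgf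
    simp only [hexp]
    rw [integral_const_mul]
    unfold GV
    rw [integral_fintype_prod_eq_pow (ι := Fin m) (fun x : ℝ => Real.exp (η * n * x ^ 2))]
    calc _ ≤ Real.exp (-(η * m)) * (Real.exp (η + 2 * η ^ 2)) ^ m := by
          simp only [Fintype.card_fin]
          gcongr
          
      _ = Real.exp (m * (2 * η ^ 2)) := by
          rw [← Real.exp_nat_mul, ← Real.exp_add]; congr 1; ring
      _ ≤ _ := by
          gcongr
  have h3 : (GV ((n : ℝ≥0))⁻¹ m).real {a | |η| * ε ≤ F a} ≤ Real.exp (-(n * (|η| * ε - 2 * η ^ 2))) := by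
    refine h1.trans ?_
    calc _ ≤ Real.exp (-n * (|η| * ε)) * Real.exp (n * (2 * η ^ 2)) := by gcongr
      _ = _ := by rw [← Real.exp_add]; congr 1; ring
  rw [← ENNReal.ofReal_toReal (measure_ne_top (GV ((n : ℝ≥0))⁻¹ m) {a | |η| * ε ≤ F a})]
  exact ENNReal.ofReal_le_ofReal h3

lemma tail_up (n m : ℕ) (hn : 0 < n) (hm : m ≤ n) (ε : ℝ) (h0 : 0 < ε) (h1 : ε ≤ 1) :
    GV ((n : ℝ≥0))⁻¹ m {a | ¬ a ⬝ᵥ a ≤ m / n + ε} ≤ ENNReal.ofReal (Real.exp (-(ε ^ 2 / 8 * n))) := by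
  have h := chernoff n m hn hm (ε / 4) ε (by rw [abs_of_pos (by linarith)]; linarith)
  rw [abs_of_pos (by linarith)] at h
  refine (measure_mono ?_).trans (h.trans (le_of_eq ?_))
  · intro a ha
    simp only [Set.mem_ofPred_eq, not_le] at ha ⊢
    nlinarith
  · congr 2; ring

lemma tail_low (n m : ℕ) (hn : 0 < n) (hm : m ≤ n) (ε : ℝ) (h0 : 0 < ε) (h1 : ε ≤ 1) :
    GV ((n : ℝ≥0))⁻¹ m {a | ¬ m / n - ε ≤ a ⬝ᵥ a} ≤ ENNReal.ofReal (Real.exp (-(ε ^ 2 / 8 * n))) := by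
  have h := chernoff n m hn hm (-(ε / 4)) ε (by rw [abs_neg, abs_of_pos (by linarith)]; linarith)
  rw [abs_neg, abs_of_pos (by linarith)] at h
  refine (measure_mono ?_).trans (h.trans (le_of_eq ?_))
  · intro a ha
    simp only [Set.mem_ofPred_eq, not_le] at ha ⊢
    nlinarith
  · congr 2; ring

/-- Matrices whose quadratic form satisfies the one-sided bound. -/
def GoodSet (s α K : ℝ) {m q : ℕ} (g : Fin q → ℝ) : Set (Fin m → Fin q → ℝ) :=
  {A | ∀ u : Fin q → ℝ, α * (u ⬝ᵥ u) + K * (g ⬝ᵥ u) ^ 2 ≤ s * ∑ i, (A i ⬝ᵥ u) ^ 2}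

lemma measurableSet_goodSet (s α K : ℝ) {m q : ℕ} (g : Fin q → ℝ) :
    MeasurableSet (GoodSet s α K (m := m) g) := by
  apply IsClosed.measurableSet
  unfold GoodSet
  rw [Set.ofPred_forall]
  refine isClosed_iInter fun u => isClosed_le continuous_const ?_
  simp only [dotProduct]
  fun_prop

lemma rot_dot {q : ℕ} (U : Matrix (Fin q) (Fin q) ℝ) (hU : U * Uᵀ = 1) (x y : Fin q → ℝ) :
    (U *ᵥ x) ⬝ᵥ (U *ᵥ y) = x ⬝ᵥ y := by
  have hU' : Uᵀ * U = 1 := mul_eq_one_comm.mp hU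
  rw [Matrix.dotProduct_mulVec, Matrix.vecMul_mulVec, ← Matrix.mulVec_transpose]
  simp [hU']

lemma dot_cons {q : ℕ} (x : ℝ) (v : Fin q → ℝ) (u : Fin (q+1) → ℝ) :
    (Fin.cons x v : Fin (q+1) → ℝ) ⬝ᵥ u = x * u 0 + v ⬝ᵥ (Fin.tail u) := by
  simp [dotProduct, Fin.sum_univ_succ, Fin.tail]

lemma dot_self_succ {q : ℕ} (u : Fin (q+1) → ℝ) :
    u ⬝ᵥ u = u 0 ^ 2 + (Fin.tail u) ⬝ᵥ (Fin.tail u) := by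
  simp [dotProduct, Fin.sum_univ_succ, Fin.tail, sq]

lemma left_rot_sum {m q : ℕ} (U : Matrix (Fin m) (Fin m) ℝ) (hU : U * Uᵀ = 1)
    (a : Fin m → ℝ) (B : Fin m → Fin q → ℝ) (u : Fin (q+1) → ℝ) :
    ∑ i, ((Fin.cons ((U *ᵥ a) i) (fun j => ∑ k, U i k * B k j) : Fin (q+1) → ℝ) ⬝ᵥ u) ^ 2
      = ∑ i, ((Fin.cons (a i) (B i) : Fin (q+1) → ℝ) ⬝ᵥ u) ^ 2 := by
  set z : Fin m → ℝ := fun i => (Fin.cons (a i) (B i) : Fin (q+1) → ℝ) ⬝ᵥ u with hz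
  have h1 : ∀ i, ((Fin.cons ((U *ᵥ a) i) (fun j => ∑ k, U i k * B k j) : Fin (q+1) → ℝ) ⬝ᵥ u)
      = (U *ᵥ z) i := by
    intro i
    have e : (U *ᵥ z) i = ∑ k, U i k * z k := rfl
    have e2 : (U *ᵥ a) i = ∑ k, U i k * a k := rfl
    rw [e, dot_cons, e2]
    simp only [hz, dot_cons, mul_add, Finset.sum_add_distrib]
    congr 1
    · rw [Finset.sum_mul]
      exact Finset.sum_congr rfl fun k _ => by ring
    · simp only [dotProduct, Finset.sum_mul, Finset.mul_sum]
      rw [Finset.sum_comm]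
      exact Finset.sum_congr rfl fun k _ => Finset.sum_congr rfl fun j _ => by ring
  simp only [h1]
  have h2 := rot_dot U hU z z
  have h3 : ∀ x : Fin m → ℝ, x ⬝ᵥ x = ∑ i, x i ^ 2 := fun x => by simp [dotProduct, sq]
  rw [h3, h3] at h2
  exact h2

lemma step_bound (v : ℝ≥0) (s α K : ℝ) (m q : ℕ) (R : Set ℝ) (hR : MeasurableSet R) (b : ℝ)
    (τ c : ℝ≥0∞)
    (hτR : GV v (m+1) {a | a ⬝ᵥ a ∉ R} ≤ τ) (hτb : GV v q {h | ¬ h ⬝ᵥ h ≤ b} ≤ τ)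
    (g : Fin (q+1) → ℝ)
    (hstep : ∀ r, 0 ≤ r → r ^ 2 ∈ R → ∀ x t : ℝ,
      (α + K * (g ⬝ᵥ g)) * x ^ 2 - K * t ^ 2 ≤ s * (r * x + t) ^ 2)
    (ih : ∀ h : Fin q → ℝ, h ⬝ᵥ h ≤ b → GM v m q (GoodSet s α K h)ᶜ ≤ c) :
    GM v (m+1) (q+1) (GoodSet s α K g)ᶜ ≤ τ + (τ + c) := by
  have hdm : ∀ k : ℕ, Measurable fun a : Fin k → ℝ => a ⬝ᵥ a := by
    intro k; simp only [dotProduct]; fun_prop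
  have dn : ∀ {k : ℕ} (a : Fin k → ℝ), 0 ≤ a ⬝ᵥ a := fun a => by
    simp only [dotProduct]; exact Finset.sum_nonneg fun i _ => mul_self_nonneg _
  obtain ⟨V, hV, hVg⟩ := exists_rot g
  set g' : Fin (q+1) → ℝ := Pi.single 0 (Real.sqrt (g ⬝ᵥ g)) with hg'
  set Bad : Set (Fin (m+1) → Fin (q+1) → ℝ) := (GoodSet s α K g')ᶜ with hBad
  have hBm : MeasurableSet Bad := (measurableSet_goodSet s α K g').compl
  have e1 : GM v (m+1) (q+1) (GoodSet s α K g)ᶜ ≤ GM v (m+1) (q+1) Bad := by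
    refine le_trans (measure_mono ?_) ((GM_rot_right v (m+1) (q+1) V hV).measure_preimage_le Bad)
    intro A hA hA2
    apply hA
    intro u
    have := hA2 (V *ᵥ u)
    simpa only [← hVg, rot_dot V hV] using this
  refine e1.trans ?_
  rw [← (GM_cons_col v (m+1) q).measure_preimage hBm.nullMeasurableSet]
  refine le_trans (prod_bound _ _ _ ((GM_cons_col v (m+1) q).measurable hBm) {a | a ⬝ᵥ a ∉ R}
    ((hdm _) hR.compl) (τ + c) ?_) (by gcongr)
  intro a ha
  simp only [Set.mem_ofPred_eq, not_not] at ha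
  obtain ⟨U, hU, hUa⟩ := exists_rot a
  set r := Real.sqrt (a ⬝ᵥ a) with hr
  have hr2 : r ^ 2 ∈ R := by rw [hr, Real.sq_sqrt (dn a)]; exact ha
  have hr0 : 0 ≤ r := Real.sqrt_nonneg _
  set r' : Fin (m+1) → ℝ := Pi.single 0 r with hr'
  set Bad2 : Set (Fin (m+1) → Fin q → ℝ) := {B | (fun i => Fin.cons (r' i) (B i) : Fin (m+1) → Fin (q+1) → ℝ) ∈ Bad}
    with hBad2
  have hB2m : MeasurableSet Bad2 := by
    have : Measurable (fun B : Fin (m+1) → Fin q → ℝ => (r', B)) := by fun_prop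
    exact ((GM_cons_col v (m+1) q).measurable.comp this) hBm
  have e2 : GM v (m+1) q {B | (a, B) ∈ (fun z : (Fin (m+1) → ℝ) × (Fin (m+1) → Fin q → ℝ) =>
      (fun i => Fin.cons (z.1 i) (z.2 i) : Fin (m+1) → Fin (q+1) → ℝ)) ⁻¹' Bad} ≤ GM v (m+1) q Bad2 := by
    refine le_trans (measure_mono ?_) ((GM_rot_left v (m+1) q U hU).measure_preimage_le Bad2)
    intro B hB hB2
    apply hB
    intro u
    have := hB2 u
    rw [← hUa, left_rot_sum U hU a B u] at this
    exact this
  refine e2.trans ?_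
  rw [← (GM_cons_row v m q).measure_preimage hB2m.nullMeasurableSet]
  refine le_trans (prod_bound _ _ _ ((GM_cons_row v m q).measurable hB2m) {h | ¬ h ⬝ᵥ h ≤ b}
    ((measurableSet_le (hdm _) measurable_const).compl) c ?_) (by gcongr)
  intro h hh
  simp only [Set.mem_ofPred_eq, not_not] at hh
  refine le_trans (measure_mono ?_) (ih h hh)
  intro A hA hA2
  apply hA
  intro u
  have h1 := hA2 (Fin.tail u)
  have h2 := hstep r hr0 hr2 (u 0) (h ⬝ᵥ Fin.tail u)
  rw [Fin.sum_univ_succ, dot_self_succ u]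
  simp only [dot_cons, Fin.cons_zero, Fin.cons_succ, hr', Pi.single_eq_same, ne_eq, Fin.succ_ne_zero,
    not_false_eq_true, Pi.single_eq_of_ne, zero_mul, zero_add, hg', single_dotProduct, mul_pow,
    Real.sq_sqrt (dn g)]
  linarith

lemma induct_bound (v : ℝ≥0) (s α K : ℝ) (d p : ℕ) (R : ℕ → Set ℝ) (hR : ∀ m, MeasurableSet (R m))
    (b : ℕ → ℝ) (τ : ℝ≥0∞)
    (hτR : ∀ m ≤ d + p, GV v m {a | a ⬝ᵥ a ∉ R m} ≤ τ)
    (hτb : ∀ q ≤ p, GV v q {h | ¬ h ⬝ᵥ h ≤ b q} ≤ τ)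
    (hstep : ∀ q < p, ∀ r, 0 ≤ r → r ^ 2 ∈ R (d + q + 1) → ∀ G, 0 ≤ G → G ≤ b (q+1) → ∀ x t : ℝ,
      (α + K * G) * x ^ 2 - K * t ^ 2 ≤ s * (r * x + t) ^ 2) :
    ∀ q ≤ p, ∀ g : Fin q → ℝ, g ⬝ᵥ g ≤ b q → GM v (d + q) q (GoodSet s α K g)ᶜ ≤ q * (2 * τ) := by
  intro q
  induction q with
  | zero =>
    intro _ g _
    have : (GoodSet s α K (m := d + 0) g)ᶜ = ∅ := by
      ext A
      simp [GoodSet]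
    simp [this]
  | succ q ih =>
    intro hq g hg
    have := step_bound v s α K (d + q) q (R (d + q + 1)) (hR _) (b q) τ (q * (2 * τ))
      (hτR _ (by omega)) (hτb q (by omega)) g
      (fun r hr0 hr x t => hstep q (by omega) r hr0 hr (g ⬝ᵥ g)
        (by simp only [dotProduct]; exact Finset.sum_nonneg fun i _ => mul_self_nonneg _) hg x t)
      (ih (by omega))
    refine this.trans (le_of_eq ?_)
    push_cast
    ring

lemma lower_ev (n d p : ℕ) (hn : n = d + 1 + p) (θ K α ε : ℝ) (h0 : 0 < θ) (h1 : θ < 1)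
    (hK : K * (1 - θ) = θ) (hε : 0 < ε) (hε1 : ε ≤ 1)
    (hc : α + K * (p / n + ε) ≤ θ * (1 - 1 / n - ε)) :
    GM ((n : ℝ≥0))⁻¹ (d + p) p (GoodSet 1 α K (0 : Fin p → ℝ))ᶜ ≤
      p * (2 * ENNReal.ofReal (Real.exp (-(ε ^ 2 / 8 * n)))) := by
  have hnpos : 0 < n := by omega
  have hn' : (0:ℝ) < n := by exact_mod_cast hnpos
  have hnr : (n:ℝ) = d + 1 + p := by rw [hn]; push_cast; ring
  have hK0 : 0 < K := by
    by_contra hcon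
    push Not at hcon
    nlinarith
  have hKθ : θ ≤ K := by nlinarith
  refine induct_bound _ 1 α K d p (fun m => {x | (m:ℝ) / n - ε ≤ x}) (fun m => measurableSet_Ici)
    (fun q => (q:ℝ) / n + ε) _ (fun m hm => tail_low n m hnpos (by omega) ε hε hε1)
    (fun q hq => tail_up n q hnpos (by omega) ε hε hε1) ?_ p le_rfl 0 ?_
  · intro q hq r hr0 hr G hG0 hG x t
    simp only [Set.mem_ofPred_eq] at hr
    push_cast at hr hG
    have hqp : (q:ℝ) + 1 ≤ p := by exact_mod_cast hq
    set w : ℝ := (p - (q + 1)) / n with hw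
    have hw0 : 0 ≤ w := div_nonneg (by linarith) hn'.le
    have e1 : ((q:ℝ) + 1) / n = p / n - w := by rw [hw]; field_simp; ring
    have e2 : ((d:ℝ) + q + 1) / n = 1 - 1 / n - w := by
      rw [hw, hnr]; rw [hnr] at hn'; field_simp; ring
    have hinv : 0 < 1 / (n:ℝ) := by positivity
    rw [e1] at hG
    rw [e2] at hr
    have key : α + K * G ≤ θ * r ^ 2 := by
      have a1 : K * G ≤ K * (p / n - w + ε) := by gcongr
      have a2 : θ * (1 - 1 / n - w - ε) ≤ θ * r ^ 2 := by gcongr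
      nlinarith
    have a3 : (α + K * G) * x ^ 2 ≤ θ * r ^ 2 * x ^ 2 := by gcongr
    have a4 : 0 ≤ (1 + K) * ((1 - θ) * r * x + t) ^ 2 := by positivity
    have a5 : (1 + K) * (1 - θ) = 1 := by linarith
    have a6 : (1 + K) * ((1 - θ) * r * x + t) ^ 2 = (1 - θ) * r ^ 2 * x ^ 2 + 2 * r * x * t + (1 + K) * t ^ 2 := by
      linear_combination ((1 - θ) * r ^ 2 * x ^ 2 + 2 * r * x * t) * a5
    nlinarith
  · simp only [zero_dotProduct]; positivity

lemma upper_ev (n d p : ℕ) (hn : n = d + p) (hnpos : 0 < n) (ε : ℝ) (hε : 0 < ε) (hε1 : ε ≤ 1) :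
    GM ((n : ℝ≥0))⁻¹ n p (GoodSet (-1) (-9) 2 (0 : Fin p → ℝ))ᶜ ≤
      p * (2 * ENNReal.ofReal (Real.exp (-(ε ^ 2 / 8 * n)))) := by
  have hn' : (0:ℝ) < n := by exact_mod_cast hnpos
  have hmn : ∀ m : ℕ, m ≤ n → (m:ℝ) / n ≤ 1 := fun m hm => by
    rw [div_le_one hn']; exact_mod_cast hm
  have h := induct_bound ((n : ℝ≥0))⁻¹ (-1) (-9) 2 d p (fun m => {x | x ≤ (m:ℝ) / n + ε}) (fun m => measurableSet_Iic)
    (fun q => (q:ℝ) / n + ε) _ (fun m hm => tail_up n m hnpos (by omega) ε hε hε1)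
    (fun q hq => tail_up n q hnpos (by omega) ε hε hε1) ?_ p le_rfl 0 ?_
  · rw [← hn] at h
    exact h
  · intro q hq r hr0 hr G hG0 hG x t
    simp only [Set.mem_ofPred_eq] at hr
    have b1 := hmn (d + q + 1) (by omega)
    have b2 := hmn (q + 1) (by omega)
    have b3 : r ^ 2 ≤ 2 := by linarith
    have b4 : G ≤ 2 := by linarith
    have b5 : (r ^ 2) * x ^ 2 ≤ 2 * x ^ 2 := by gcongr
    have b6 : G * x ^ 2 ≤ 2 * x ^ 2 := by gcongr
    nlinarith [sq_nonneg (r * x - t), sq_nonneg x]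
  · simp only [zero_dotProduct]; positivity

lemma duality {n p : ℕ} (A : Fin n → Fin p → ℝ) (M : ℝ) (hM : 0 ≤ M)
    (h : ∀ u : Fin p → ℝ, ∑ i, (A i ⬝ᵥ u) ^ 2 ≤ M * ∑ j, u j ^ 2) (v : Fin n → ℝ) :
    ∑ j, (∑ t, A t j * v t) ^ 2 ≤ M * ∑ t, v t ^ 2 := by
  set u : Fin p → ℝ := fun j => ∑ t, A t j * v t with hu
  set S := ∑ j, u j ^ 2 with hS
  have hS0 : 0 ≤ S := Finset.sum_nonneg fun j _ => sq_nonneg _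
  have hV0 : 0 ≤ ∑ t, v t ^ 2 := Finset.sum_nonneg fun j _ => sq_nonneg _
  have e : S = ∑ t, v t * (A t ⬝ᵥ u) := by
    calc S = ∑ j, (∑ t, A t j * v t) * u j := Finset.sum_congr rfl fun j _ => by rw [sq]
      _ = ∑ j, ∑ t, v t * (A t j * u j) := by
          refine Finset.sum_congr rfl fun j _ => ?_
          rw [Finset.sum_mul]
          exact Finset.sum_congr rfl fun t _ => by ring
      _ = _ := by
          rw [Finset.sum_comm]
          exact Finset.sum_congr rfl fun t _ => by rw [dotProduct, Finset.mul_sum]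
  have cs := Finset.sum_mul_sq_le_sq_mul_sq Finset.univ v (fun t => A t ⬝ᵥ u)
  rw [← e] at cs
  have h2 : S ^ 2 ≤ (M * ∑ t, v t ^ 2) * S := by
    calc S ^ 2 ≤ _ := cs
      _ ≤ (∑ t, v t ^ 2) * (M * S) := by gcongr; exact h u
      _ = _ := by ring
  rcases hS0.eq_or_lt with h3 | h3
  · rw [← h3]; positivity
  · exact le_of_mul_le_mul_right (by rw [← sq]; exact h2) h3

lemma fixed_k {Ω : Type} [MeasureSpace Ω] (hprob : IsProbabilityMeasure (MeasureTheory.volume : Measure Ω))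
    (δ : ℝ) (hδ : 1 < δ) (p n : ℕ) (hp : 2 ≤ p) (hpn : p < n)
    (X : Ω → Matrix (Fin n) (Fin p) ℝ)
    (hXmeas : Measurable fun ω => fun q : Fin n × Fin p => X ω q.1 q.2)
    (hXlaw : Measure.map (fun ω => fun q : Fin n × Fin p => X ω q.1 q.2)
        MeasureTheory.volume = Measure.pi fun _ => gaussianReal 0 ((n : ℝ≥0))⁻¹)
    (θ K α ε c : ℝ) (h0 : 0 < θ) (h1 : θ < 1)
    (hK : K * (1 - θ) = θ) (hε : 0 < ε) (hε1 : ε ≤ 1)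
    (hc : α + K * (p / n + ε) ≤ θ * (1 - 1 / n - ε)) (hcα : c ≤ α) :
      1 - 8 * ((p : ℝ) - 1) * ((n : ℝ) + (p : ℝ) + 1) * Real.exp (-(ε ^ 2 / 8 * n)) ≤
      (MeasureTheory.volume {ω : Ω |
        (∀ u : Fin p → ℝ,
          (∑ i, ((X ω *ᵥ u) i) ^ 2) ≤ 9 * δ ^ 2 * ∑ j, u j ^ 2) ∧
        (∀ i : Fin n, ∀ u : Fin p → ℝ,
          (∑ j ∈ Finset.univ.erase i, ((X ω *ᵥ u) j) ^ 2) ≤ 9 * δ ^ 2 * ∑ j, u j ^ 2) ∧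
        (∀ i : Fin p, ∀ v : Fin n → ℝ,
          (∑ j ∈ Finset.univ.erase i, (∑ t, X ω t j * v t) ^ 2)
            ≤ 9 * δ ^ 2 * ∑ t, v t ^ 2) ∧
        (∀ i : Fin p, ∀ u : Fin p → ℝ, u i = 0 →
          (∑ t, ((X ω *ᵥ u) t) ^ 2) ≤ 9 * δ ^ 2 * ∑ j, u j ^ 2) ∧
        (∀ u : Fin p → ℝ,
          c * ∑ j, u j ^ 2
            ≤ ∑ i, ((X ω *ᵥ u) i) ^ 2) ∧
        (∀ i : Fin n, ∀ u : Fin p → ℝ,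
          c * ∑ j, u j ^ 2
            ≤ ∑ j ∈ Finset.univ.erase i, ((X ω *ᵥ u) j) ^ 2) ∧
        (∀ i : Fin p, ∀ u : Fin p → ℝ, u i = 0 →
          c * ∑ j, u j ^ 2
            ≤ ∑ t, ((X ω *ᵥ u) t) ^ 2)}).toReal := by
  obtain ⟨d, rfl⟩ : ∃ d, n = d + p + 1 := ⟨n - p - 1, by omega⟩
  set E : Set Ω := {ω : Ω | _} with hE
  set Y : Ω → (Fin (d + p + 1) → Fin p → ℝ) := fun ω i j => X ω i j with hY
  have hYmp : MeasurePreserving Y volume (GM (((d + p + 1 : ℕ) : ℝ≥0))⁻¹ (d + p + 1) p) :=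
    (GM_curry _ (d + p + 1) p).comp ⟨hXmeas, hXlaw⟩
  set B1 : Set Ω := Y ⁻¹' (GoodSet (-1) (-9) 2 (0 : Fin p → ℝ))ᶜ with hB1
  set B2 : Fin (d + p + 1) → Set Ω := fun i => (fun ω => fun j : Fin (d + p) => Y ω (i.succAbove j)) ⁻¹'
    (GoodSet 1 α K (0 : Fin p → ℝ))ᶜ with hB2
  set τ := ENNReal.ofReal (Real.exp (-(ε ^ 2 / 8 * ((d + p + 1 : ℕ) : ℝ)))) with hτ
  have m1 : volume B1 ≤ p * (2 * τ) :=
    (hYmp.measure_preimage_le _).trans (upper_ev (d + p + 1) (d + 1) p (by omega) (by omega) ε hε hε1)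
  have m2 : ∀ i, volume (B2 i) ≤ p * (2 * τ) := fun i =>
    (((GM_remove_row _ (d + p) p i).comp hYmp).measure_preimage_le _).trans
      (lower_ev (d + p + 1) d p (by omega) θ K α ε h0 h1 hK hε hε1 hc)
  have hdot : ∀ u : Fin p → ℝ, u ⬝ᵥ u = ∑ j, u j ^ 2 := fun u => by simp [dotProduct, sq]
  have sub : Eᶜ ⊆ B1 ∪ ⋃ i, B2 i := by
    intro ω hω
    by_contra hcon
    simp only [Set.mem_union, Set.mem_iUnion, not_or, not_exists, hB1, hB2, Set.mem_preimage,
      Set.mem_compl_iff, not_not] at hcon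
    obtain ⟨g1, g2⟩ := hcon
    apply hω
    have hδ2 : (9:ℝ) ≤ 9 * δ ^ 2 := by nlinarith
    have sq0 : ∀ {k : ℕ} (u : Fin k → ℝ), 0 ≤ ∑ j, u j ^ 2 :=
      fun u => Finset.sum_nonneg fun j _ => sq_nonneg _
    have up : ∀ u : Fin p → ℝ, ∑ i, ((X ω *ᵥ u) i) ^ 2 ≤ 9 * δ ^ 2 * ∑ j, u j ^ 2 := by
      intro u
      have h := g1 u
      rw [hdot, zero_dotProduct] at h
      have h' : ∑ i, ((X ω *ᵥ u) i) ^ 2 ≤ 9 * ∑ j, u j ^ 2 := by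
        have : ∑ i, ((X ω *ᵥ u) i) ^ 2 = ∑ i, (Y ω i ⬝ᵥ u) ^ 2 := rfl
        rw [this]
        linarith
      exact h'.trans (mul_le_mul_of_nonneg_right hδ2 (sq0 u))
    have low : ∀ i : Fin (d + p + 1), ∀ u : Fin p → ℝ, c * ∑ j, u j ^ 2
            ≤ ∑ j ∈ Finset.univ.erase i, ((X ω *ᵥ u) j) ^ 2 := by
      intro i u
      have h := g2 i u
      rw [hdot, zero_dotProduct] at h
      have e1 := Fin.sum_univ_succAbove (fun j => ((X ω *ᵥ u) j) ^ 2) i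
      have e2 := Finset.add_sum_erase Finset.univ (fun j => ((X ω *ᵥ u) j) ^ 2) (Finset.mem_univ i)
      have e3 : ∑ j, ((X ω *ᵥ u) (i.succAbove j)) ^ 2 = ∑ j, (Y ω (i.succAbove j) ⬝ᵥ u) ^ 2 := rfl
      have e4 : c * ∑ j, u j ^ 2 ≤ α * ∑ j, u j ^ 2 := mul_le_mul_of_nonneg_right hcα (sq0 u)
      linarith
    have erase_le : ∀ {k : ℕ} (i : Fin k) (f : Fin k → ℝ), ∑ j ∈ Finset.univ.erase i, f j ^ 2 ≤ ∑ j, f j ^ 2 :=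
      fun i f => Finset.sum_le_sum_of_subset_of_nonneg (Finset.erase_subset _ _) fun _ _ _ => sq_nonneg _
    have low' : ∀ u : Fin p → ℝ, c * ∑ j, u j ^ 2 ≤ ∑ j, ((X ω *ᵥ u) j) ^ 2 :=
      fun u => (low 0 u).trans (erase_le _ _)
    exact ⟨up, fun i u => (erase_le _ _).trans (up u),
      fun i v => (erase_le i (fun j => ∑ t, X ω t j * v t)).trans (duality (Y ω) (9 * δ ^ 2) (by positivity) up v),
      fun i u _ => up u, low', low, fun i u _ => low' u⟩
  have tot : volume Eᶜ ≤ ENNReal.ofReal (2 * p * (((d + p + 1 : ℕ)) + 1) * Real.exp (-(ε ^ 2 / 8 * ((d + p + 1 : ℕ) : ℝ)))) := by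
    calc volume Eᶜ ≤ volume B1 + ∑ i, volume (B2 i) :=
          (measure_mono sub).trans ((measure_union_le _ _).trans (by gcongr; exact measure_iUnion_fintype_le _ _))
      _ ≤ p * (2 * τ) + ∑ i : Fin (d + p + 1), p * (2 * τ) := by gcongr; exact m2 _
      _ = 2 * p * (((d + p + 1 : ℕ)) + 1) * τ := by
          simp only [Finset.sum_const, Finset.card_univ, Fintype.card_fin, nsmul_eq_mul]; ring
      _ = _ := by
          rw [hτ, ENNReal.ofReal_mul (by positivity), ENNReal.ofReal_mul (by positivity),
            ENNReal.ofReal_mul (by positivity), ENNReal.ofReal_add (by positivity) (by positivity),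
            ENNReal.ofReal_natCast, ENNReal.ofReal_natCast, ENNReal.ofReal_one, ENNReal.ofReal_ofNat]
  have tot' : (volume Eᶜ).toReal ≤ 2 * p * (((d + p + 1 : ℕ)) + 1) * Real.exp (-(ε ^ 2 / 8 * ((d + p + 1 : ℕ) : ℝ))) :=
    ENNReal.toReal_le_of_le_ofReal (by positivity) tot
  have one : 1 ≤ (volume E).toReal + (volume Eᶜ).toReal := by
    rw [← ENNReal.toReal_add (measure_ne_top _ _) (measure_ne_top _ _)]
    have := measure_union_le (μ := (volume : Measure Ω)) E Eᶜ
    rw [Set.union_compl_self, measure_univ] at this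
    have h2 := ENNReal.toReal_mono (by simp [measure_ne_top]) this
    simpa using h2
  have hp' : (2:ℝ) ≤ p := by exact_mod_cast hp
  have hn0 : (0:ℝ) ≤ ((d + p + 1 : ℕ) : ℝ) := by positivity
  have fin : 2 * (p:ℝ) * (((d + p + 1 : ℕ)) + 1) * Real.exp (-(ε ^ 2 / 8 * ((d + p + 1 : ℕ) : ℝ))) ≤
      8 * ((p : ℝ) - 1) * (((d + p + 1 : ℕ) : ℝ) + (p : ℝ) + 1) * Real.exp (-(ε ^ 2 / 8 * ((d + p + 1 : ℕ) : ℝ))) := by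
    apply mul_le_mul_of_nonneg_right _ (Real.exp_pos _).le
    have : 2 * (p:ℝ) ≤ 8 * (p - 1) := by linarith
    apply mul_le_mul this <;> linarith
  linarith

/-- Eigenvalue bounds for Gaussian design matrices and their
row/column-deleted versions, holding simultaneously with exponentially high
probability. Eigenvalue bounds are expressed through quadratic forms. -/
theorem gaussian_design_eigenvalue_bounds
    {Ω : Type} [MeasureSpace Ω]
    (hprob : IsProbabilityMeasure (MeasureTheory.volume : Measure Ω))
    (δ : ℝ) (hδ : 1 < δ)
    (p n : ℕ → ℕ) (hp : ∀ k, 0 < p k) (hn : ∀ k, 0 < n k)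
    (hp_top : Filter.Tendsto p Filter.atTop Filter.atTop)
    (hratio : ∀ k, (n k : ℝ) = δ * p k)
    (X : ∀ k, Ω → Matrix (Fin (n k)) (Fin (p k)) ℝ)
    (hXmeas : ∀ k, Measurable fun ω => fun q : Fin (n k) × Fin (p k) => X k ω q.1 q.2)
    (hXlaw : ∀ k, Measure.map (fun ω => fun q : Fin (n k) × Fin (p k) => X k ω q.1 q.2)
        MeasureTheory.volume = Measure.pi fun _ => gaussianReal 0 ((n k : ℝ≥0))⁻¹) :
    ∃ cst : ℝ, 0 < cst ∧ ∃ N : ℕ, ∀ k : ℕ, N < k →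
      1 - 8 * ((p k : ℝ) - 1) * ((n k : ℝ) + (p k : ℝ) + 1) * Real.exp (-(cst * n k)) ≤
      (MeasureTheory.volume {ω : Ω |
        (∀ u : Fin (p k) → ℝ,
          (∑ i, ((X k ω *ᵥ u) i) ^ 2) ≤ 9 * δ ^ 2 * ∑ j, u j ^ 2) ∧
        (∀ i : Fin (n k), ∀ u : Fin (p k) → ℝ,
          (∑ j ∈ Finset.univ.erase i, ((X k ω *ᵥ u) j) ^ 2) ≤ 9 * δ ^ 2 * ∑ j, u j ^ 2) ∧
        (∀ i : Fin (p k), ∀ v : Fin (n k) → ℝ,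
          (∑ j ∈ Finset.univ.erase i, (∑ t, X k ω t j * v t) ^ 2)
            ≤ 9 * δ ^ 2 * ∑ t, v t ^ 2) ∧
        (∀ i : Fin (p k), ∀ u : Fin (p k) → ℝ, u i = 0 →
          (∑ t, ((X k ω *ᵥ u) t) ^ 2) ≤ 9 * δ ^ 2 * ∑ j, u j ^ 2) ∧
        (∀ u : Fin (p k) → ℝ,
          (1 / 2 * min ((1 - Real.sqrt (1 / δ)) ^ 2) (1 / δ)) * ∑ j, u j ^ 2
            ≤ ∑ i, ((X k ω *ᵥ u) i) ^ 2) ∧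
        (∀ i : Fin (n k), ∀ u : Fin (p k) → ℝ,
          (1 / 2 * min ((1 - Real.sqrt (1 / δ)) ^ 2) (1 / δ)) * ∑ j, u j ^ 2
            ≤ ∑ j ∈ Finset.univ.erase i, ((X k ω *ᵥ u) j) ^ 2) ∧
        (∀ i : Fin (p k), ∀ u : Fin (p k) → ℝ, u i = 0 →
          (1 / 2 * min ((1 - Real.sqrt (1 / δ)) ^ 2) (1 / δ)) * ∑ j, u j ^ 2
            ≤ ∑ t, ((X k ω *ᵥ u) t) ^ 2)}).toReal := by
  have hδ0 : 0 < δ := by linarith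
  set σ := Real.sqrt (1 / δ) with hσ
  have hσ2 : σ ^ 2 = 1 / δ := Real.sq_sqrt (by positivity)
  have hσ0 : 0 < σ := Real.sqrt_pos.mpr (by positivity)
  have hy1 : 1 / δ < 1 := by rw [div_lt_one hδ0]; exact hδ
  have hσ1 : σ < 1 := by nlinarith
  set α : ℝ := 1 / 2 * (1 - σ) ^ 2 with hα
  have hα0 : 0 < α := by
    have : 0 < 1 - σ := by linarith
    positivity
  set K : ℝ := (1 - σ) / σ with hKdef
  have hK0 : 0 < K := div_pos (by linarith) hσ0
  have hKσ : K * σ = 1 - σ := div_mul_cancel₀ _ hσ0.ne'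
  set ε : ℝ := min 1 (α / (2 * (1 + K))) with hεdef
  have hε0 : 0 < ε := lt_min one_pos (by positivity)
  have hε1 : ε ≤ 1 := min_le_left _ _
  have hε2 : (1 + K) * ε ≤ α / 2 := by
    have : ε ≤ α / (2 * (1 + K)) := min_le_right _ _
    calc (1 + K) * ε ≤ (1 + K) * (α / (2 * (1 + K))) := by gcongr
      _ = α / 2 := by field_simp
  refine ⟨ε ^ 2 / 8, by positivity, ?_⟩
  obtain ⟨M, hM⟩ := exists_nat_ge (2 / α)
  obtain ⟨N, hN⟩ := Filter.eventually_atTop.mp (hp_top.eventually_ge_atTop (max 2 M))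
  refine ⟨N, fun k hk => ?_⟩
  have hpk := hN k hk.le
  have hp2 : 2 ≤ p k := (le_max_left _ _).trans hpk
  have hpM : M ≤ p k := (le_max_right _ _).trans hpk
  have hppos : (0:ℝ) < p k := by exact_mod_cast hp k
  have hnpos : (0:ℝ) < n k := by exact_mod_cast hn k
  have hpn' : (p k : ℝ) < n k := by rw [hratio k]; nlinarith
  have hpn : p k < n k := by exact_mod_cast hpn'
  have hdiv : (p k : ℝ) / n k = σ ^ 2 := by rw [hσ2, hratio k]; field_simp
  have hinv : 1 / (n k : ℝ) ≤ α / 2 := by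
    have h1 : 2 / α ≤ n k := hM.trans (le_trans (by exact_mod_cast hpM) hpn'.le)
    rw [div_le_iff₀ hα0] at h1
    rw [div_le_iff₀ hnpos]
    linarith
  refine fixed_k hprob δ hδ (p k) (n k) hp2 hpn (X k) (hXmeas k) (hXlaw k) (1 - σ) K α ε _
    (by linarith) (by linarith) (by rw [sub_sub_cancel]; exact hKσ) hε0 hε1 ?_ ?_
  · rw [hdiv]
    have a1 : (1 - σ) * (1 / (n k : ℝ)) ≤ α / 2 := by
      have : 0 < 1 / (n k : ℝ) := by positivity
      nlinarith
    have a2 : K * σ ^ 2 = (1 - σ) * σ := by rw [sq, ← mul_assoc, hKσ]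
    have a3 : 0 ≤ σ * ε := by positivity
    nlinarith
  · rw [hα]
    gcongr
    exact min_le_left _ _
end
end

section
/- Let X ∈ ℝ^{n×p} have i.i.d. N(0,1/n) entries with n = δp for fixed δ > 1, and let σ_min(XᵀX) denote the minimum eigenvalue of XᵀX. Then for every fixed r ≥ 0 there exists a constant K (depending only on r and δ) such that for all sufficiently large n, E[ 1 / σ_min(XᵀX)^r ] ≤ K. -/
open MeasureTheory ProbabilityTheory Matrix Filter Finset
open scoped NNReal ENNReal

noncomputable section

lemma row_law (p : ℕ) (v v' : ℝ≥0) (w : Fin p → ℝ) (hv : (v' : ℝ) = v * ∑ j, w j ^ 2) :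
    (Measure.pi (fun _ : Fin p => gaussianReal 0 v)).map (fun x => ∑ j, x j * w j)
      = gaussianReal 0 v' := by
  have hm : Measurable (fun x : Fin p → ℝ => ∑ j, x j * w j) := by fun_prop
  have : IsProbabilityMeasure ((Measure.pi (fun _ : Fin p => gaussianReal 0 v)).map (fun x => ∑ j, x j * w j)) :=
    Measure.isProbabilityMeasure_map hm.aemeasurable
  apply Measure.ext_of_charFun
  ext t
  rw [charFun_apply_real, integral_map hm.aemeasurable (by fun_prop)]
  have h1 : ∀ x : Fin p → ℝ, Complex.exp (t * ((∑ j, x j * w j : ℝ) : ℂ) * Complex.I)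
      = ∏ j, Complex.exp (((t * w j : ℝ) : ℂ) * (x j : ℂ) * Complex.I) := by
    intro x
    rw [← Complex.exp_sum]
    congr 1
    push_cast
    rw [Finset.mul_sum, Finset.sum_mul]
    exact Finset.sum_congr rfl fun j _ => by ring
  simp_rw [h1]
  rw [integral_fintype_prod_eq_prod (μ := fun _ : Fin p => gaussianReal 0 v) (f := fun j (y : ℝ) => Complex.exp (((t * w j : ℝ) : ℂ) * (y : ℂ) * Complex.I))]
  have h2 : ∀ j, ∫ y, Complex.exp (((t * w j : ℝ) : ℂ) * (y : ℂ) * Complex.I) ∂gaussianReal 0 v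
      = Complex.exp (- (v * (t * w j)^2 / 2)) := by
    intro j
    rw [← charFun_apply_real, charFun_gaussianReal]
    simp
  simp_rw [h2]
  rw [← Complex.exp_sum, charFun_gaussianReal]
  congr 1
  have hv2 : (v' : ℂ) = v * ∑ j, (w j : ℂ) ^ 2 := by exact_mod_cast congrArg (fun z : ℝ => (z : ℂ)) hv
  simp only [hv2, Complex.ofReal_zero, mul_zero, zero_mul, zero_sub, Finset.sum_neg_distrib]
  congr 1
  simp only [Finset.sum_div, Finset.mul_sum, Finset.sum_mul]
  exact Finset.sum_congr rfl fun j _ => by ring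

lemma factor (n p : ℕ) (v v' : ℝ≥0) (w : Fin p → ℝ) (hv : (v' : ℝ) = v * ∑ j, w j ^ 2) (f : ℝ → ℝ≥0∞) (hf : Measurable f) :
    ∫⁻ x, ∏ i, f (∑ j, x (i, j) * w j) ∂(Measure.pi fun _ : Fin n × Fin p => gaussianReal 0 v)
      = (∫⁻ y, f y ∂gaussianReal 0 v') ^ n := by
  have h1 : (Measure.pi fun _ : Fin n × Fin p => gaussianReal 0 v).map (MeasurableEquiv.curry (Fin n) (Fin p) ℝ)
      = Measure.pi fun _ : Fin n => Measure.pi fun _ : Fin p => gaussianReal 0 v := by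
    have := Measure.infinitePi_map_curry (fun (_ : Fin n) (_ : Fin p) => gaussianReal 0 v)
    simpa only [Measure.infinitePi_eq_pi] using this
  have h2 : ∫⁻ x, ∏ i, f (∑ j, x (i, j) * w j) ∂(Measure.pi fun _ : Fin n × Fin p => gaussianReal 0 v)
    = ∫⁻ z, ∏ i, f (∑ j, z i j * w j) ∂((Measure.pi fun _ : Fin n × Fin p => gaussianReal 0 v).map (MeasurableEquiv.curry (Fin n) (Fin p) ℝ)) := by
    rw [lintegral_map (by fun_prop) (by fun_prop)]
    rfl
  rw [h2, h1]
  have h3 := lintegral_prod_eq_prod_lintegral_of_indepFun (μ := Measure.pi fun _ : Fin n => Measure.pi fun _ : Fin p => gaussianReal 0 v) Finset.univ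
    (fun i z => f (∑ j, z i j * w j)) (iIndepFun_pi (X := fun i (z : Fin p → ℝ) => f (∑ j, z j * w j)) (fun i => (hf.comp (by fun_prop)).aemeasurable)) (fun i => by fun_prop)
  rw [h3, ← row_law p v v' w hv, lintegral_map hf (by fun_prop)]
  have h4 : ∀ i : Fin n, ∫⁻ z, f (∑ j, z i j * w j) ∂(Measure.pi fun _ : Fin n => Measure.pi fun _ : Fin p => gaussianReal 0 v)
     = ∫⁻ a, f (∑ j, a j * w j) ∂(Measure.pi fun _ : Fin p => gaussianReal 0 v) := by
    intro i
    exact (measurePreserving_eval (fun _ : Fin n => Measure.pi fun _ : Fin p => gaussianReal 0 v) i).lintegral_comp (f := fun a => f (∑ j, a j * w j)) (by fun_prop)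
  simp_rw [h4]
  simp

lemma pdf_le (s : ℝ≥0) (h1 : 1 / 4 ≤ (s : ℝ)) (h2 : (s : ℝ) ≤ 4) (x : ℝ) :
    gaussianPDF 0 s x ≤ ENNReal.ofReal (Real.exp (-(1/8) * x ^ 2)) := by
  unfold gaussianPDF gaussianPDFReal
  apply ENNReal.ofReal_le_ofReal
  have h3 : (√(2 * Real.pi * s))⁻¹ ≤ 1 := by
    apply inv_le_one_of_one_le₀
    rw [Real.one_le_sqrt]
    nlinarith [Real.pi_gt_three]
  have h4 : -(x - 0) ^ 2 / (2 * (s : ℝ)) ≤ -(1/8) * x ^ 2 := by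
    rw [div_le_iff₀ (by linarith)]
    nlinarith [sq_nonneg x]
  calc _ ≤ 1 * Real.exp (-(1/8) * x ^ 2) := by
        gcongr
    _ = _ := one_mul _

lemma gauss_lint_le (s : ℝ≥0) (h1 : 1 / 4 ≤ (s : ℝ)) (h2 : (s : ℝ) ≤ 4) (f : ℝ → ℝ≥0∞) (hf : Measurable f) :
    ∫⁻ y, f y ∂gaussianReal 0 s ≤ ∫⁻ y, ENNReal.ofReal (Real.exp (-(1/8) * y ^ 2)) * f y := by
  have hs : s ≠ 0 := by
    rintro rfl
    norm_num at h1
  rw [gaussianReal_of_var_ne_zero _ hs, lintegral_withDensity_eq_lintegral_mul _ (measurable_gaussianPDF 0 s) hf]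
  exact lintegral_mono fun y => mul_le_mul_left (pdf_le s h1 h2 y) _

lemma fin1 (b : ℝ) (hb : b < 1 / 2) :
    ∫⁻ y : ℝ, ENNReal.ofReal (Real.exp (-(1/8) * y ^ 2)) * (ENNReal.ofReal (y ^ 2)) ^ (-b) < ∞ := by
  have h0 := (integrableOn_rpow_mul_exp_neg_mul_sq (b := 1/8) (s := -2*b) (by norm_num) (by linarith))
  have h1 : Integrable (fun x : ℝ => |x| ^ (-2 * b) * Real.exp (-(1/8) * |x| ^ 2)) := by
    have hp : IntegrableOn (fun x : ℝ => |x| ^ (-2 * b) * Real.exp (-(1/8) * |x| ^ 2)) (Set.Ioi 0) :=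
      h0.congr_fun (fun x hx => by simp only [abs_of_pos (Set.mem_Ioi.mp hx)]) measurableSet_Ioi
    have hn : IntegrableOn (fun x : ℝ => |x| ^ (-2 * b) * Real.exp (-(1/8) * |x| ^ 2)) (Set.Iic 0) := by
      rw [integrableOn_Iic_iff_integrableOn_Iio]
      have := hp.comp_neg
      simpa using this
    rw [← integrableOn_univ, ← Set.Iic_union_Ioi (a := (0:ℝ))]
    exact hn.union hp
  refine lt_of_le_of_lt (le_of_eq ?_) h1.lintegral_lt_top
  apply lintegral_congr_ae
  have h2 : ∀ᵐ y : ℝ, y ≠ 0 := by simp [ae_iff]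
  filter_upwards [h2] with y hy
  have hy2 : 0 < |y| := abs_pos.mpr hy
  rw [ENNReal.ofReal_rpow_of_pos (by positivity), ← ENNReal.ofReal_mul (by positivity), mul_comm, sq_abs, ← sq_abs y,
    ← Real.rpow_natCast, ← Real.rpow_mul hy2.le]
  congr 3
  push_cast
  ring

lemma fin2 :
    ∫⁻ y : ℝ, ENNReal.ofReal (Real.exp (-(1/8) * y ^ 2)) * ENNReal.ofReal (Real.exp (1/16 * y^2)) < ∞ := by
  have h1 := integrable_exp_neg_mul_sq (b := 1/16) (by norm_num)
  refine lt_of_le_of_lt (le_of_eq ?_) h1.lintegral_lt_top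
  congr 1
  ext y
  rw [← ENNReal.ofReal_mul (by positivity), ← Real.exp_add]
  congr 2
  ring

/-- The annulus over which we average. -/
def Ann (p : ℕ) : Set (EuclideanSpace ℝ (Fin p)) := {u | 1 / 2 ≤ ‖u‖ ∧ ‖u‖ ≤ 2}

lemma measurableSet_Ann (p : ℕ) : MeasurableSet (Ann p) := by
  unfold Ann
  measurability

/-- The annular integral of the product functional. -/
def AA (n p : ℕ) (f : ℝ → ℝ≥0∞) (x : Fin n × Fin p → ℝ) : ℝ≥0∞ :=
  ∫⁻ u in Ann p, ∏ i, f (∑ j, x (i, j) * (√n * u j))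

/-- Volume of the Euclidean unit ball. -/
def VB (p : ℕ) : ℝ≥0∞ := volume (Metric.ball (0 : EuclideanSpace ℝ (Fin p)) 1)

lemma VB_ne_zero (p : ℕ) : VB p ≠ 0 := (Metric.measure_ball_pos _ _ one_pos).ne'
lemma VB_ne_top (p : ℕ) : VB p ≠ ∞ := measure_ball_lt_top.ne

lemma measurable_int (n p : ℕ) (f : ℝ → ℝ≥0∞) (hf : Measurable f) :
    Measurable (fun q : (Fin n × Fin p → ℝ) × EuclideanSpace ℝ (Fin p) =>
      ∏ i, f (∑ j, q.1 (i, j) * (√n * q.2 j))) := by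
  apply Finset.measurable_prod
  intro i _
  apply hf.comp
  fun_prop

lemma measurable_AA (n p : ℕ) (f : ℝ → ℝ≥0∞) (hf : Measurable f) : Measurable (AA n p f) :=
  (measurable_int n p f hf).lintegral_prod_right'

lemma vol_Ann_le (p : ℕ) : volume (Ann p) ≤ ENNReal.ofReal (2 ^ p) * VB p := by
  calc volume (Ann p) ≤ volume (Metric.closedBall (0 : EuclideanSpace ℝ (Fin p)) 2) := by
        apply measure_mono
        intro u hu
        simpa using hu.2
    _ = _ := by
        rw [Measure.addHaar_closedBall _ _ (by norm_num)]
        simp [VB]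

lemma lint_AA_le (n p : ℕ) (hn : 0 < n) (f : ℝ → ℝ≥0∞) (hf : Measurable f) :
    ∫⁻ x, AA n p f x ∂(Measure.pi fun _ : Fin n × Fin p => gaussianReal 0 ((n : ℝ≥0))⁻¹)
      ≤ (∫⁻ y, ENNReal.ofReal (Real.exp (-(1/8) * y ^ 2)) * f y) ^ n * (ENNReal.ofReal (2 ^ p) * VB p) := by
  unfold AA
  rw [lintegral_lintegral_swap (measurable_int n p f hf).aemeasurable]
  calc _ ≤ ∫⁻ u in Ann p, (∫⁻ y, ENNReal.ofReal (Real.exp (-(1/8) * y ^ 2)) * f y) ^ n := by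
        apply setLIntegral_mono' (measurableSet_Ann p)
        intro u hu
        have hs : (((Real.toNNReal (‖u‖ ^ 2)) : ℝ≥0) : ℝ) = (((n : ℝ≥0)⁻¹ : ℝ≥0) : ℝ) * ∑ j, (√n * u j) ^ 2 := by
          have hn' : (n : ℝ) ≠ 0 := by positivity
          rw [Real.coe_toNNReal _ (by positivity), EuclideanSpace.norm_sq_eq]
          simp only [mul_pow, ← Finset.mul_sum, Real.norm_eq_abs, sq_abs]
          rw [Real.sq_sqrt (by positivity)]
          push_cast
          field_simp
        rw [factor n p _ (Real.toNNReal (‖u‖ ^ 2)) (fun j => √n * u j) hs f hf]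
        have hc : (((Real.toNNReal (‖u‖ ^ 2)) : ℝ≥0) : ℝ) = ‖u‖ ^ 2 := Real.coe_toNNReal _ (by positivity)
        have := gauss_lint_le (Real.toNNReal (‖u‖ ^ 2)) (by rw [hc]; nlinarith [hu.1]) (by rw [hc]; nlinarith [hu.2, hu.1]) f hf
        gcongr
    _ = (∫⁻ y, ENNReal.ofReal (Real.exp (-(1/8) * y ^ 2)) * f y) ^ n * volume (Ann p) := by
        rw [setLIntegral_const]
    _ ≤ _ := by
        gcongr
        exact vol_Ann_le p

lemma AA_ge (n p : ℕ) (f : ℝ → ℝ≥0∞) (x : Fin n × Fin p → ℝ) (v : EuclideanSpace ℝ (Fin p)) (ε : ℝ) (hε : 0 < ε)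
    (hb : Metric.ball v ε ⊆ Ann p) (c : ℝ≥0∞) (hc : ∀ u ∈ Metric.ball v ε, c ≤ ∏ i, f (∑ j, x (i, j) * (√n * u j))) :
    c * (ENNReal.ofReal (ε ^ p) * VB p) ≤ AA n p f x := by
  unfold AA
  calc c * (ENNReal.ofReal (ε ^ p) * VB p) = ∫⁻ u in Metric.ball v ε, c := by
        rw [setLIntegral_const, Measure.addHaar_ball_of_pos _ _ hε]
        simp [VB]
    _ ≤ ∫⁻ u in Metric.ball v ε, ∏ i, f (∑ j, x (i, j) * (√n * u j)) :=
        setLIntegral_mono' Metric.isOpen_ball.measurableSet hc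
    _ ≤ _ := lintegral_mono_set hb

lemma amgm (n : ℕ) (hn : 0 < n) (y : Fin n → ℝ) :
    ∏ i, (√n * y i) ^ 2 ≤ (∑ i, y i ^ 2) ^ n := by
  have h := Real.geom_mean_le_arith_mean_weighted Finset.univ (fun _ : Fin n => (1 / n : ℝ)) (fun i => (√n * y i) ^ 2)
    (fun _ _ => by positivity) (by simp; field_simp) (fun _ _ => by positivity)
  rw [Real.finsetProd_rpow _ _ (fun _ _ => by positivity)] at h
  have hn' : (n : ℝ) ≠ 0 := by positivity
  have h2 : ∑ i, (1 / n : ℝ) * (√n * y i) ^ 2 = ∑ i, y i ^ 2 := by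
    apply Finset.sum_congr rfl
    intro i _
    rw [mul_pow, Real.sq_sqrt (by positivity)]
    field_simp
  rw [h2] at h
  have h3 := pow_le_pow_left₀ (by positivity) h n
  rwa [one_div, Real.rpow_inv_natCast_pow (by positivity) hn.ne'] at h3

/-- negative power functional -/
def f1 (b : ℝ) (y : ℝ) : ℝ≥0∞ := (ENNReal.ofReal (y ^ 2)) ^ (-b)
/-- exponential functional -/
def f2 (y : ℝ) : ℝ≥0∞ := ENNReal.ofReal (Real.exp (1/16 * y^2))

lemma measurable_f1 (b : ℝ) : Measurable (f1 b) := by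
  unfold f1
  fun_prop
lemma measurable_f2 : Measurable f2 := by
  unfold f2
  fun_prop

lemma f1_ge (b : ℝ) (hb : 0 < b) (n : ℕ) (hn : 0 < n) (y : Fin n → ℝ) (L : ℝ) (hL : 0 < L)
    (hy : ∑ i, y i ^ 2 ≤ L) :
    ENNReal.ofReal (L ^ (-(b * n))) ≤ ∏ i, f1 b (√n * y i) := by
  unfold f1
  rw [ENNReal.prod_rpow_of_ne_top (fun _ _ => ENNReal.ofReal_ne_top)]
  rw [← ENNReal.ofReal_prod_of_nonneg (fun _ _ => by positivity)]
  have h : ∏ i, (√n * y i) ^ 2 ≤ L ^ n :=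
    (amgm n hn y).trans (pow_le_pow_left₀ (by positivity) hy n)
  have h2 : ENNReal.ofReal (L ^ (-(b * n))) = (ENNReal.ofReal (L ^ n)) ^ (-b) := by
    rw [ENNReal.ofReal_rpow_of_pos (by positivity), ← Real.rpow_natCast, ← Real.rpow_mul hL.le]
    congr 2
    ring
  rw [h2]
  rw [ENNReal.rpow_neg, ENNReal.rpow_neg, ENNReal.inv_le_inv]
  exact ENNReal.rpow_le_rpow (ENNReal.ofReal_le_ofReal h) hb.le

lemma f2_ge (n : ℕ) (y : Fin n → ℝ) (L : ℝ) (hL : 0 ≤ L)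
    (hy : L ≤ ∑ i, y i ^ 2) :
    ENNReal.ofReal ((L / 16) ^ n) ≤ ∏ i, f2 (√n * y i) := by
  unfold f2
  rw [← ENNReal.ofReal_prod_of_nonneg (fun _ _ => by positivity), ← Real.exp_sum]
  apply ENNReal.ofReal_le_ofReal
  have h1 : ∑ i, 1 / 16 * (√n * y i) ^ 2 = n * ((∑ i, y i ^ 2) / 16) := by
    simp only [mul_pow, ← Finset.mul_sum]
    rw [Real.sq_sqrt (by positivity)]
    ring
  rw [h1, Real.exp_nat_mul]
  apply pow_le_pow_left₀ (by positivity)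
  have := Real.add_one_le_exp ((∑ i, y i ^ 2) / 16)
  linarith

lemma geom {p : ℕ} {F : Type*} [NormedAddCommGroup F] [NormedSpace ℝ F] (T : EuclideanSpace ℝ (Fin p) →L[ℝ] F)
    (σ : ℝ) (hσ : 0 < σ) (v : EuclideanSpace ℝ (Fin p)) (hv : ‖v‖ = 1) (hv1 : ‖T v‖ ≤ 2 * σ)
    (hv2 : σ ≤ ‖T v‖) :
    ∃ B : ℝ, 0 < B ∧ (Metric.ball v (σ / (2 * B)) ⊆ Ann p ∧ ∀ u ∈ Metric.ball v (σ / (2 * B)), ‖T u‖ ≤ 3 * σ) ∧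
      ∃ w, Metric.ball w (1 / 4) ⊆ Ann p ∧ ∀ u ∈ Metric.ball w (1 / 4), B / 2 ≤ ‖T u‖ := by
  have hB1 : σ ≤ ‖T‖ := by
    have := T.le_opNorm v
    rw [hv, mul_one] at this
    linarith
  have hB : 0 < ‖T‖ := by linarith
  refine ⟨‖T‖, hB, ⟨?_, ?_⟩, ?_⟩
  · intro u hu
    have h1 : σ / (2 * ‖T‖) ≤ 1 / 2 := by
      rw [div_le_iff₀ (by positivity)]
      linarith
    rw [mem_ball_iff_norm] at hu
    have h2 := norm_sub_norm_le u v
    have h3 := norm_sub_norm_le v u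
    rw [norm_sub_rev] at h3
    constructor <;> linarith
  · intro u hu
    rw [mem_ball_iff_norm] at hu
    have h1 : ‖T (u - v)‖ ≤ σ := by
      calc _ ≤ ‖T‖ * ‖u - v‖ := T.le_opNorm _
        _ ≤ ‖T‖ * (σ / (2 * ‖T‖)) := by gcongr
        _ = σ / 2 := by field_simp
        _ ≤ σ := by linarith
    have h2 : T u = T (u - v) + T v := by simp
    rw [h2]
    have := norm_add_le (T (u - v)) (T v)
    linarith
  · obtain ⟨w, hw1, hw2⟩ := T.exists_lt_apply_of_lt_opNorm (r := 3 / 4 * ‖T‖) (by linarith)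
    have hw3 : 3 / 4 < ‖w‖ := by
      have := T.le_opNorm w
      nlinarith
    refine ⟨w, ?_, ?_⟩
    · intro u hu
      rw [mem_ball_iff_norm] at hu
      have h2 := norm_sub_norm_le u w
      have h3 := norm_sub_norm_le w u
      rw [norm_sub_rev] at h3
      constructor <;> linarith
    · intro u hu
      rw [mem_ball_iff_norm] at hu
      have h1 : ‖T (u - w)‖ ≤ ‖T‖ / 4 := by
        calc _ ≤ ‖T‖ * ‖u - w‖ := T.le_opNorm _
          _ ≤ ‖T‖ * (1 / 4) := by gcongr
          _ = _ := by ring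
      have h2 : T w = T u - T (u - w) := by simp
      have := norm_sub_le (T u) (T (u - w))
      rw [← h2] at this
      linarith

lemma pointwise (n p : ℕ) (hn : 0 < n) (b : ℝ) (hb : 0 < b) (x : Fin n × Fin p → ℝ) (lam : ℝ) (hlam : 0 < lam)
    (h1 : ∃ u : Fin p → ℝ, ∑ j, u j ^ 2 = 1 ∧ ∑ i, (∑ j, x (i, j) * u j) ^ 2 < 4 * lam)
    (h2 : ∀ u : Fin p → ℝ, ∑ j, u j ^ 2 = 1 → lam ≤ ∑ i, (∑ j, x (i, j) * u j) ^ 2) :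
    ∃ B : ℝ, 0 < B ∧
      ENNReal.ofReal ((9 * lam) ^ (-(b * n))) * (ENNReal.ofReal ((√lam / (2 * B)) ^ p) * VB p) ≤ AA n p (f1 b) x ∧
      ENNReal.ofReal ((B ^ 2 / 4 / 16) ^ n) * (ENNReal.ofReal ((1 / 4) ^ p) * VB p) ≤ AA n p f2 x := by
  let T : EuclideanSpace ℝ (Fin p) →L[ℝ] EuclideanSpace ℝ (Fin n) :=
    (Matrix.toLpLin 2 2 (Matrix.of fun i j => x (i, j))).toContinuousLinearMap
  have hT : ∀ u, ‖T u‖ ^ 2 = ∑ i, (∑ j, x (i, j) * u j) ^ 2 := by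
    intro u
    rw [EuclideanSpace.norm_sq_eq]
    simp [T, Matrix.mulVec, dotProduct]
  obtain ⟨u, hu1, hu2⟩ := h1
  have hσ : 0 < √lam := Real.sqrt_pos.mpr hlam
  have hσ2 : √lam ^ 2 = lam := Real.sq_sqrt hlam.le
  have e1 : ‖T (WithLp.toLp 2 u)‖ ^ 2 < 4 * lam := by rw [hT]; exact hu2
  have e2 : lam ≤ ‖T (WithLp.toLp 2 u)‖ ^ 2 := by rw [hT]; exact h2 u hu1
  obtain ⟨B, hB, ⟨hs1, hs2⟩, w, hw1, hw2⟩ := geom T (√lam) hσ (WithLp.toLp 2 u)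
    (by rw [EuclideanSpace.norm_eq]; simp [hu1])
    (by refine (sq_le_sq₀ (by positivity) (by positivity)).mp ?_; nlinarith)
    (by refine (sq_le_sq₀ (by positivity) (by positivity)).mp ?_; nlinarith)
  refine ⟨B, hB, ?_, ?_⟩
  · apply AA_ge n p _ x _ _ (by positivity) hs1
    intro z hz
    have := f1_ge b hb n hn (fun i => ∑ j, x (i, j) * z j) (9 * lam) (by positivity)
      (by rw [← hT]; nlinarith [hs2 z hz, norm_nonneg (T z)])
    convert this using 4
    rw [Finset.mul_sum]
    exact Finset.sum_congr rfl fun j _ => by ring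
  · apply AA_ge n p _ x w _ (by positivity) hw1
    intro z hz
    have := f2_ge n (fun i => ∑ j, x (i, j) * z j) (B ^ 2 / 4) (by positivity)
      (by rw [← hT]; nlinarith [hw2 z hz, norm_nonneg (T z)])
    convert this using 4
    rw [Finset.mul_sum]
    exact Finset.sum_congr rfl fun j _ => by ring

lemma realineq (δ r : ℝ) (hδ : 1 < δ) (hr : 0 ≤ r) (p n : ℕ) (hp : 0 < p) (hn : (n : ℝ) = δ * p)
    (hpr : 8 * r / (δ - 1) ≤ p) (C1 C2 lam B : ℝ) (hC1 : 1 ≤ C1) (hC2 : 1 ≤ C2) (hlam : 0 < lam) (hB : 0 < B) :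
    1 / lam ^ r ≤ (36 * C1 + 512 * C2) ^ (8 * r * δ / (δ - 1)) *
      (1 + (9 * lam) ^ (-((δ + 1) / (4 * δ) * n)) * (√lam / (2 * B)) ^ p / (C1 ^ n * 2 ^ p)
        + (B ^ 2 / 4 / 16) ^ n * (1 / 4) ^ p / (C2 ^ n * 2 ^ p)) := by
  have hp' : (0 : ℝ) < p := by exact_mod_cast hp
  have hδ1 : 0 < δ - 1 := by linarith
  have hpn : p ≤ n := by
    have : (p : ℝ) ≤ n := by rw [hn]; nlinarith
    exact_mod_cast this
  have hbn : (δ + 1) / (4 * δ) * n = (δ + 1) * p / 4 := by rw [hn]; field_simp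
  rw [hbn]
  set M := 36 * C1 + 512 * C2 with hM
  have hM1 : 1 ≤ M := by linarith
  set a := (9 * lam) ^ (-((δ + 1) * p / 4)) * (√lam / (2 * B)) ^ p / (C1 ^ n * 2 ^ p) with ha
  set d := (B ^ 2 / 4 / 16) ^ n * (1 / 4) ^ p / (C2 ^ n * 2 ^ p) with hd
  have ha0 : 0 < a := by positivity
  have hd0 : 0 < d := by positivity
  have hG : lam ^ (-((δ - 1) * p / 4)) * (B ^ p)⁻¹ ≤ a * M ^ n := by
    have e1 : lam ^ (-((δ - 1) * p / 4)) = lam ^ (-((δ + 1) * p / 4)) * √lam ^ p := by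
      rw [Real.sqrt_eq_rpow, ← Real.rpow_natCast, ← Real.rpow_mul hlam.le, ← Real.rpow_add hlam]
      congr 1
      ring
    have e2 : lam ^ (-((δ - 1) * p / 4)) * (B ^ p)⁻¹
        = a * (9 ^ ((δ + 1) * p / 4) * (2 ^ p * 2 ^ p) * C1 ^ n) := by
      rw [e1, ha, Real.mul_rpow (by norm_num) hlam.le, Real.rpow_neg (by norm_num : (0:ℝ) ≤ 9), div_pow, mul_pow]
      field_simp
    rw [e2]
    apply mul_le_mul_of_nonneg_left _ ha0.le
    calc (9:ℝ) ^ ((δ + 1) * p / 4) * (2 ^ p * 2 ^ p) * C1 ^ n ≤ 9 ^ (n : ℝ) * (2 ^ n * 2 ^ n) * C1 ^ n := by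
          gcongr
          · norm_num
          · rw [hn]; nlinarith
          · norm_num
          · norm_num
      _ = (36 * C1) ^ n := by
          rw [Real.rpow_natCast, ← mul_pow, ← mul_pow, ← mul_pow]
          norm_num
      _ ≤ M ^ n := by gcongr; linarith
  have hH : B ^ (2 * n) ≤ d * M ^ n := by
    have e2 : B ^ (2 * n) = d * (64 ^ n * 4 ^ p * C2 ^ n * 2 ^ p) := by
      rw [hd, div_div, div_pow, div_pow, ← pow_mul]
      norm_num
      field_simp
    rw [e2]
    apply mul_le_mul_of_nonneg_left _ hd0.le
    calc (64:ℝ) ^ n * 4 ^ p * C2 ^ n * 2 ^ p ≤ 64 ^ n * 4 ^ n * C2 ^ n * 2 ^ n := by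
          gcongr <;> norm_num
      _ = (512 * C2) ^ n := by
          rw [← mul_pow, ← mul_pow, ← mul_pow]
          congr 1
          ring
      _ ≤ M ^ n := by gcongr; linarith
  set S := 1 + a + d with hS
  have hS1 : 1 ≤ S := by linarith
  set θ := 4 * r / ((δ - 1) * p) with hθ
  have hθ0 : 0 ≤ θ := by positivity
  have hθ1 : θ ≤ 1 / 2 := by
    rw [hθ, div_le_iff₀ (by positivity)]
    rw [div_le_iff₀ hδ1] at hpr
    linarith
  set θ' := θ / (2 * δ) with hθ'
  have hθ'0 : 0 ≤ θ' := by positivity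
  have hθ'1 : θ' ≤ θ := by
    rw [hθ', div_le_iff₀ (by linarith)]
    nlinarith
  have key : 1 / lam ^ r = (lam ^ (-((δ - 1) * p / 4)) * (B ^ p)⁻¹) ^ θ * (B ^ (2 * n)) ^ θ' := by
    rw [Real.mul_rpow (by positivity) (by positivity), ← Real.rpow_mul hlam.le, Real.inv_rpow (by positivity)]
    have e1 : (B ^ (2 * n)) ^ θ' = (B ^ p) ^ θ := by
      rw [← Real.rpow_natCast, ← Real.rpow_natCast, ← Real.rpow_mul hB.le, ← Real.rpow_mul hB.le]
      congr 1
      push_cast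
      rw [hn, hθ']
      field_simp
    have e2 : -((δ - 1) * p / 4) * θ = -r := by
      rw [hθ]
      field_simp
    have e3 : (B ^ p) ^ θ ≠ 0 := by positivity
    rw [e1, e2, Real.rpow_neg hlam.le, one_div]
    field_simp
  rw [key]
  calc (lam ^ (-((δ - 1) * p / 4)) * (B ^ p)⁻¹) ^ θ * (B ^ (2 * n)) ^ θ'
      ≤ (S * M ^ n) ^ θ * (S * M ^ n) ^ θ' := by
        have q1 : lam ^ (-((δ - 1) * p / 4)) * (B ^ p)⁻¹ ≤ S * M ^ n :=
          hG.trans (mul_le_mul_of_nonneg_right (by linarith) (by positivity))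
        have q2 : B ^ (2 * n) ≤ S * M ^ n :=
          hH.trans (mul_le_mul_of_nonneg_right (by linarith) (by positivity))
        exact mul_le_mul (Real.rpow_le_rpow (by positivity) q1 hθ0)
          (Real.rpow_le_rpow (by positivity) q2 hθ'0) (by positivity) (by positivity)
    _ = (S * M ^ n) ^ (θ + θ') := by rw [Real.rpow_add (by positivity)]
    _ = S ^ (θ + θ') * M ^ (n * (θ + θ')) := by
        rw [Real.mul_rpow (by positivity) (by positivity), ← Real.rpow_natCast, ← Real.rpow_mul (by positivity)]
    _ ≤ S ^ (1 : ℝ) * M ^ (8 * r * δ / (δ - 1)) := by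
        have e : 8 * r * δ / (δ - 1) = n * (θ + θ) := by
          rw [hn, hθ]
          field_simp
          ring
        rw [e]
        have q : n * (θ + θ') ≤ n * (θ + θ) := by gcongr
        exact mul_le_mul (Real.rpow_le_rpow_of_exponent_le hS1 (by linarith))
          (Real.rpow_le_rpow_of_exponent_le hM1 q) (by positivity) (by positivity)
    _ = _ := by rw [Real.rpow_one, mul_comm]

lemma final_k (δ r : ℝ) (hδ : 1 < δ) (hr : 0 ≤ r) (p n : ℕ) (hp : 0 < p) (hn : (n : ℝ) = δ * p)
    (hpr : 8 * r / (δ - 1) ≤ p) (C1 C2 : ℝ) (hC1 : 1 ≤ C1) (hC2 : 1 ≤ C2)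
    (h1 : ∫⁻ y : ℝ, ENNReal.ofReal (Real.exp (-(1/8) * y ^ 2)) * f1 ((δ + 1) / (4 * δ)) y ≤ ENNReal.ofReal C1)
    (h2 : ∫⁻ y : ℝ, ENNReal.ofReal (Real.exp (-(1/8) * y ^ 2)) * f2 y ≤ ENNReal.ofReal C2)
    {Ω : Type} [MeasureSpace Ω] (X : Ω → Matrix (Fin n) (Fin p) ℝ)
    (hXmeas : Measurable fun ω => fun q : Fin n × Fin p => X ω q.1 q.2)
    (hXlaw : Measure.map (fun ω => fun q : Fin n × Fin p => X ω q.1 q.2)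
        MeasureTheory.volume = Measure.pi fun _ => gaussianReal 0 ((n : ℝ≥0))⁻¹) :
    (∫⁻ ω, ENNReal.ofReal
          (1 / (⨅ u : {u : Fin p → ℝ // ∑ j, u j ^ 2 = 1},
              ∑ i, ((X ω *ᵥ (u : Fin p → ℝ)) i) ^ 2) ^ r))
        ≤ ENNReal.ofReal ((36 * C1 + 512 * C2) ^ (8 * r * δ / (δ - 1)) * 3) := by
  have hn0 : 0 < n := by
    have : (0 : ℝ) < n := by rw [hn]; positivity
    exact_mod_cast this
  set K0 := (36 * C1 + 512 * C2) ^ (8 * r * δ / (δ - 1)) with hK0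
  have hK01 : 1 ≤ K0 := Real.one_le_rpow (by linarith) (div_nonneg (by positivity) (by linarith))
  set b := (δ + 1) / (4 * δ) with hb
  have hb0 : 0 < b := by positivity
  set D1 := ENNReal.ofReal (C1 ^ n * 2 ^ p) * VB p with hD1
  set D2 := ENNReal.ofReal (C2 ^ n * 2 ^ p) * VB p with hD2
  have hD1p : 0 < C1 ^ n * 2 ^ p := by positivity
  have hD2p : 0 < C2 ^ n * 2 ^ p := by positivity
  have hD1z : D1 ≠ 0 := mul_ne_zero (ENNReal.ofReal_pos.mpr hD1p).ne' (VB_ne_zero p)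
  have hD2z : D2 ≠ 0 := mul_ne_zero (ENNReal.ofReal_pos.mpr hD2p).ne' (VB_ne_zero p)
  have hD1t : D1 ≠ ∞ := ENNReal.mul_ne_top ENNReal.ofReal_ne_top (VB_ne_top p)
  have hD2t : D2 ≠ ∞ := ENNReal.mul_ne_top ENNReal.ofReal_ne_top (VB_ne_top p)
  have hdiv : ∀ (A : ℝ≥0∞) (s t c : ℝ), 0 ≤ s → 0 < c →
      ENNReal.ofReal s * (ENNReal.ofReal t * VB p) ≤ A →
      ENNReal.ofReal (s * t / c) ≤ A / (ENNReal.ofReal c * VB p) := by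
    intro A s t c hs hc h
    rw [ENNReal.le_div_iff_mul_le (Or.inl (mul_ne_zero (ENNReal.ofReal_pos.mpr hc).ne' (VB_ne_zero p)))
      (Or.inl (ENNReal.mul_ne_top ENNReal.ofReal_ne_top (VB_ne_top p))), ← mul_assoc, ← ENNReal.ofReal_mul' hc.le,
      div_mul_cancel₀ _ hc.ne', ENNReal.ofReal_mul hs, mul_assoc]
    exact h
  set G : (Fin n × Fin p → ℝ) → ℝ≥0∞ := fun x =>
    ENNReal.ofReal K0 * (1 + AA n p (f1 b) x / D1 + AA n p f2 x / D2) with hG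
  have hm1 := measurable_AA n p (f1 b) (measurable_f1 b)
  have hm2 := measurable_AA n p f2 measurable_f2
  have hGm : Measurable G := by fun_prop
  have hpt : ∀ ω, ENNReal.ofReal
          (1 / (⨅ u : {u : Fin p → ℝ // ∑ j, u j ^ 2 = 1},
              ∑ i, ((X ω *ᵥ (u : Fin p → ℝ)) i) ^ 2) ^ r) ≤ G (fun q => X ω q.1 q.2) := by
    intro ω
    set lam := ⨅ u : {u : Fin p → ℝ // ∑ j, u j ^ 2 = 1},
              ∑ i, ((X ω *ᵥ (u : Fin p → ℝ)) i) ^ 2 with hlamdef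
    have hlam0 : 0 ≤ lam := Real.iInf_nonneg fun u => by positivity
    rcases hlam0.eq_or_lt with h0 | hpos
    · have : 1 / lam ^ r ≤ 1 := by
        rw [← h0]
        rcases hr.eq_or_lt with hr0 | hr0
        · rw [← hr0]; simp
        · rw [Real.zero_rpow hr0.ne']; simp
      calc ENNReal.ofReal (1 / lam ^ r) ≤ ENNReal.ofReal K0 * 1 := by
            rw [mul_one]
            exact ENNReal.ofReal_le_ofReal (this.trans hK01)
        _ ≤ _ := by
            simp only [hG]
            gcongr
            rw [add_assoc]
            exact le_self_add
    · have hne : Nonempty {u : Fin p → ℝ // ∑ j, u j ^ 2 = 1} :=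
        ⟨⟨Pi.single ⟨0, hp⟩ 1, by simp [Pi.single_apply]⟩⟩
      obtain ⟨u, hu⟩ := exists_lt_of_ciInf_lt (show lam < 4 * lam by linarith)
      obtain ⟨B, hB, hA1, hA2⟩ := pointwise n p hn0 b hb0 (fun q => X ω q.1 q.2) lam hpos
        ⟨u.1, u.2, hu⟩ (fun w hw => ciInf_le (f := fun u : {u : Fin p → ℝ // ∑ j, u j ^ 2 = 1} =>
              ∑ i, ((X ω *ᵥ (u : Fin p → ℝ)) i) ^ 2) ⟨0, by rintro _ ⟨u, rfl⟩; positivity⟩ ⟨w, hw⟩)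
      have hre := realineq δ r hδ hr p n hp hn hpr C1 C2 lam B hC1 hC2 hpos hB
      refine (ENNReal.ofReal_le_ofReal hre).trans ?_
      rw [ENNReal.ofReal_mul (by positivity), ENNReal.ofReal_add (by positivity) (by positivity),
        ENNReal.ofReal_add (by positivity) (by positivity), ENNReal.ofReal_one]
      simp only [hG]
      gcongr
      · exact hdiv _ _ _ _ (by positivity) hD1p hA1
      · exact hdiv _ _ _ _ (by positivity) hD2p hA2
  have hE : ∀ (f : ℝ → ℝ≥0∞) (C : ℝ), Measurable f → 1 ≤ C →
      ∫⁻ y : ℝ, ENNReal.ofReal (Real.exp (-(1/8) * y ^ 2)) * f y ≤ ENNReal.ofReal C →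
      ∫⁻ x, AA n p f x ∂(Measure.pi fun _ : Fin n × Fin p => gaussianReal 0 ((n : ℝ≥0))⁻¹)
        ≤ ENNReal.ofReal (C ^ n * 2 ^ p) * VB p := by
    intro f C hf hC h
    refine (lint_AA_le n p hn0 f hf).trans ?_
    rw [ENNReal.ofReal_mul (pow_nonneg (by linarith) n), ENNReal.ofReal_pow (by linarith : 0 ≤ C) n, mul_assoc]
    gcongr
  calc _ ≤ ∫⁻ ω, G (fun q => X ω q.1 q.2) := lintegral_mono hpt
    _ = ∫⁻ x, G x ∂(Measure.pi fun _ : Fin n × Fin p => gaussianReal 0 ((n : ℝ≥0))⁻¹) := by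
        rw [← hXlaw, lintegral_map hGm hXmeas]
    _ = ENNReal.ofReal K0 * (1 + (∫⁻ x, AA n p (f1 b) x ∂(Measure.pi fun _ : Fin n × Fin p => gaussianReal 0 ((n : ℝ≥0))⁻¹)) / D1
          + (∫⁻ x, AA n p f2 x ∂(Measure.pi fun _ : Fin n × Fin p => gaussianReal 0 ((n : ℝ≥0))⁻¹)) / D2) := by
        simp only [hG, div_eq_mul_inv]
        rw [lintegral_const_mul _ (by fun_prop), lintegral_add_left (by fun_prop), lintegral_add_left (by fun_prop),
          lintegral_mul_const _ hm1, lintegral_mul_const _ hm2]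
        simp
    _ ≤ ENNReal.ofReal K0 * (1 + 1 + 1) := by
        gcongr
        · exact ENNReal.div_le_of_le_mul (by rw [one_mul]; exact hE _ _ (measurable_f1 b) hC1 h1)
        · exact ENNReal.div_le_of_le_mul (by rw [one_mul]; exact hE _ _ measurable_f2 hC2 h2)
    _ = _ := by
        rw [ENNReal.ofReal_mul (by positivity)]
        norm_num

/-- For a Gaussian design with `n = δp`, `δ > 1`, all inverse moments of
the smallest eigenvalue of `XᵀX` are uniformly bounded for large `n`. The smallest
eigenvalue is expressed as the infimum of the Rayleigh quotient over the unit sphere. -/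
theorem inverse_min_eigenvalue_moments
    {Ω : Type} [MeasureSpace Ω]
    (hprob : IsProbabilityMeasure (MeasureTheory.volume : Measure Ω))
    (δ : ℝ) (hδ : 1 < δ)
    (p n : ℕ → ℕ) (hp : ∀ k, 0 < p k) (hn : ∀ k, 0 < n k)
    (hp_top : Filter.Tendsto p Filter.atTop Filter.atTop)
    (hratio : ∀ k, (n k : ℝ) = δ * p k)
    (X : ∀ k, Ω → Matrix (Fin (n k)) (Fin (p k)) ℝ)
    (hXmeas : ∀ k, Measurable fun ω => fun q : Fin (n k) × Fin (p k) => X k ω q.1 q.2)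
    (hXlaw : ∀ k, Measure.map (fun ω => fun q : Fin (n k) × Fin (p k) => X k ω q.1 q.2)
        MeasureTheory.volume = Measure.pi fun _ => gaussianReal 0 ((n k : ℝ≥0))⁻¹) :
    ∀ r : ℝ, 0 ≤ r → ∃ K : ℝ, 0 < K ∧ ∃ N : ℕ, ∀ k : ℕ, N < k →
      (∫⁻ ω, ENNReal.ofReal
          (1 / (⨅ u : {u : Fin (p k) → ℝ // ∑ j, u j ^ 2 = 1},
              ∑ i, ((X k ω *ᵥ (u : Fin (p k) → ℝ)) i) ^ 2) ^ r))
        ≤ ENNReal.ofReal K := by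
  intro r hr
  have hb : (δ + 1) / (4 * δ) < 1 / 2 := by
    rw [div_lt_div_iff₀ (by linarith) (by norm_num)]
    linarith
  have hF1 : ∫⁻ y : ℝ, ENNReal.ofReal (Real.exp (-(1/8) * y ^ 2)) * f1 ((δ + 1) / (4 * δ)) y < ∞ :=
    fin1 _ hb
  have hF2 : ∫⁻ y : ℝ, ENNReal.ofReal (Real.exp (-(1/8) * y ^ 2)) * f2 y < ∞ := fin2
  obtain ⟨C1, hC1, h1⟩ : ∃ C1 : ℝ, 1 ≤ C1 ∧
      ∫⁻ y : ℝ, ENNReal.ofReal (Real.exp (-(1/8) * y ^ 2)) * f1 ((δ + 1) / (4 * δ)) y ≤ ENNReal.ofReal C1 :=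
    ⟨max 1 _, le_max_left _ _, (ENNReal.ofReal_toReal hF1.ne).symm.le.trans
      (ENNReal.ofReal_le_ofReal (le_max_right _ _))⟩
  obtain ⟨C2, hC2, h2⟩ : ∃ C2 : ℝ, 1 ≤ C2 ∧
      ∫⁻ y : ℝ, ENNReal.ofReal (Real.exp (-(1/8) * y ^ 2)) * f2 y ≤ ENNReal.ofReal C2 :=
    ⟨max 1 _, le_max_left _ _, (ENNReal.ofReal_toReal hF2.ne).symm.le.trans
      (ENNReal.ofReal_le_ofReal (le_max_right _ _))⟩
  refine ⟨(36 * C1 + 512 * C2) ^ (8 * r * δ / (δ - 1)) * 3, by positivity, ?_⟩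
  obtain ⟨N, hN⟩ := Filter.eventually_atTop.mp
    ((tendsto_natCast_atTop_atTop (R := ℝ)).comp hp_top |>.eventually_ge_atTop (8 * r / (δ - 1)))
  refine ⟨N, fun k hk => ?_⟩
  exact final_k δ r hδ hr (p k) (n k) (hp k) (hratio k) (hN k hk.le) C1 C2 hC1 hC2 h1 h2
    (X k) (hXmeas k) (hXlaw k)
end
end
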